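/- Let u be a 1-minimizer in an open set Ω ⊂ X, and let S_u := {x : u^∧(x) < u^∨(x)} be the jump set of u. Then each of the representatives u^∨, u^∧, and the precise representative ũ := (u^∧ + u^∨)/2 is continuous at every point x ∈ Ω ∖ S_u. -/

import Mathlib

open MeasureTheory Metric Filter Set
open scoped ENNReal NNReal Topology

noncomputable section

namespace MetricBV

variable {X : Type*} [MetricSpace X] [MeasurableSpace X]

/-- A rectifiable curve, encoded as a Lipschitz map on the interval `[0,1]`
(every rectifiable curve admits such a reparametrization). -/
structure Curve (X : Type*) [MetricSpace X] where
  toFun : ℝ → X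
  lipschitz : ∃ K : ℝ≥0, LipschitzOnWith K toFun (Set.Icc 0 1)

/-- The metric speed of a curve at a point. -/
def speed (γ : ℝ → X) (t : ℝ) : ℝ≥0∞ :=
  Filter.limsup (fun h : ℝ => ENNReal.ofReal (dist (γ (t + h)) (γ t) / |h|)) (𝓝[≠] (0 : ℝ))

/-- The curve integral `∫_γ g ds`. -/
def curveIntegral (g : X → ℝ≥0∞) (γ : Curve X) : ℝ≥0∞ :=
  ∫⁻ t in Set.Icc (0 : ℝ) 1, g (γ.toFun t) * speed γ.toFun t

/-- A curve lies in a set `Ω`. -/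
def Curve.In (γ : Curve X) (Ω : Set X) : Prop :=
  ∀ t ∈ Set.Icc (0 : ℝ) 1, γ.toFun t ∈ Ω

/-- The 1-modulus of a family of curves. -/
def Mod1 (μ : Measure X) (Γ : Set (Curve X)) : ℝ≥0∞ :=
  ⨅ (ρ : X → ℝ≥0∞) (_ : Measurable ρ) (_ : ∀ γ ∈ Γ, 1 ≤ curveIntegral ρ γ),
    ∫⁻ x, ρ x ∂μ

/-- `g` is an upper gradient of `u` in `Ω`: the upper gradient inequality holds
along every curve contained in `Ω`. -/
def IsUpperGradientOn (g : X → ℝ≥0∞) (u : X → ℝ) (Ω : Set X) : Prop :=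
  ∀ γ : Curve X, γ.In Ω →
    ENNReal.ofReal |u (γ.toFun 1) - u (γ.toFun 0)| ≤ curveIntegral g γ

/-- `g` is a 1-weak upper gradient of `u` in `Ω`: the upper gradient inequality holds
along every curve in `Ω` outside a family of zero 1-modulus. -/
def IsWeakUpperGradientOn (μ : Measure X) (g : X → ℝ≥0∞) (u : X → ℝ) (Ω : Set X) : Prop :=
  ∃ Γ : Set (Curve X), Mod1 μ Γ = 0 ∧
    ∀ γ : Curve X, γ ∉ Γ → γ.In Ω →
      ENNReal.ofReal |u (γ.toFun 1) - u (γ.toFun 0)| ≤ curveIntegral g γ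

/-- Membership in the Newtonian space `N^{1,1}(X)`. -/
def MemN11 (μ : Measure X) (u : X → ℝ) : Prop :=
  Integrable u μ ∧ ∃ g : X → ℝ≥0∞, Measurable g ∧
    IsWeakUpperGradientOn μ g u Set.univ ∧ ∫⁻ x, g x ∂μ < ⊤

/-- The 1-capacity `cap₁(A) = inf ‖u‖_{N^{1,1}(X)}` over `u ∈ N^{1,1}(X)` with `u ≥ 1` on `A`. -/
def cap1 (μ : Measure X) (A : Set X) : ℝ≥0∞ :=
  ⨅ (u : X → ℝ) (_ : MemN11 μ u) (_ : ∀ x ∈ A, 1 ≤ u x)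
    (g : X → ℝ≥0∞) (_ : Measurable g) (_ : IsWeakUpperGradientOn μ g u Set.univ),
    (∫⁻ x, ENNReal.ofReal |u x| ∂μ + ∫⁻ x, g x ∂μ)

/-- The variational 1-capacity `cap₁(A,Ω) = inf ∫ g_u dμ` over `u ∈ N^{1,1}(X)` with
`u ≥ 1` on `A` and `u = 0` on `X ∖ Ω`. -/
def vcap1 (μ : Measure X) (A Ω : Set X) : ℝ≥0∞ :=
  ⨅ (u : X → ℝ) (_ : MemN11 μ u) (_ : ∀ x ∈ A, 1 ≤ u x) (_ : ∀ x ∈ Ωᶜ, u x = 0)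
    (g : X → ℝ≥0∞) (_ : Measurable g) (_ : IsWeakUpperGradientOn μ g u Set.univ),
    ∫⁻ x, g x ∂μ

/-- Locally Lipschitz in `Ω`: Lipschitz on every compact subset of `Ω`. -/
def LocLipschitzOn (u : X → ℝ) (Ω : Set X) : Prop :=
  ∀ K : Set X, IsCompact K → K ⊆ Ω → ∃ L : ℝ≥0, LipschitzOnWith L u K

/-- Convergence `v i → u` in `L¹_loc(Ω)`. -/
def TendstoL1Loc (μ : Measure X) (v : ℕ → X → ℝ) (u : X → ℝ) (Ω : Set X) : Prop :=
  ∀ K : Set X, IsCompact K → K ⊆ Ω →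
    Filter.Tendsto (fun i => ∫⁻ x in K, ENNReal.ofReal |v i x - u x| ∂μ)
      Filter.atTop (𝓝 0)

/-- The total variation `‖Du‖(Ω)` of `u` in an open set `Ω`: the infimum of
`liminf ∫_Ω g_i dμ` over sequences of locally Lipschitz functions `v i → u` in `L¹_loc(Ω)`
with `g i` a 1-weak upper gradient of `v i` in `Ω`. -/
def tv (μ : Measure X) (u : X → ℝ) (Ω : Set X) : ℝ≥0∞ :=
  ⨅ (v : ℕ → X → ℝ) (_ : ∀ i, LocLipschitzOn (v i) Ω) (_ : TendstoL1Loc μ v u Ω)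
    (g : ℕ → X → ℝ≥0∞) (_ : ∀ i, Measurable (g i))
    (_ : ∀ i, IsWeakUpperGradientOn μ (g i) (v i) Ω),
    Filter.liminf (fun i => ∫⁻ x in Ω, g i x ∂μ) Filter.atTop

/-- The total variation `‖Du‖(A)` for an arbitrary set `A`. -/
def tvs (μ : Measure X) (u : X → ℝ) (A : Set X) : ℝ≥0∞ :=
  ⨅ (U : Set X) (_ : IsOpen U) (_ : A ⊆ U), tv μ u U

/-- The characteristic function of a set, as a real-valued function. -/
def chi (E : Set X) : X → ℝ := Set.indicator E fun _ => (1 : ℝ)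

/-- The perimeter `P(E,Ω) = ‖Dχ_E‖(Ω)` of `E` in an open set `Ω`. -/
def perim (μ : Measure X) (E : Set X) (Ω : Set X) : ℝ≥0∞ := tv μ (chi E) Ω

/-- `u ∈ BV(Ω)`: `u ∈ L¹(Ω)` and `‖Du‖(Ω) < ∞`. -/
def MemBV (μ : Measure X) (u : X → ℝ) (Ω : Set X) : Prop :=
  IntegrableOn u Ω μ ∧ tv μ u Ω < ⊤

/-- `u ∈ BV_loc(Ω)`. -/
def MemBVloc (μ : Measure X) (u : X → ℝ) (Ω : Set X) : Prop :=
  ∀ K : Set X, IsCompact K → K ⊆ Ω → ∃ U : Set X, IsOpen U ∧ K ⊆ U ∧ U ⊆ Ω ∧ MemBV μ u U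

/-- `φ ∈ BV_c(Ω)`: a BV function with compact support in `Ω`. -/
def MemBVc (μ : Measure X) (φ : X → ℝ) (Ω : Set X) : Prop :=
  MemBV μ φ Ω ∧ IsCompact (tsupport φ) ∧ tsupport φ ⊆ Ω

/-- `u` is a 1-minimizer (function of least gradient) in `Ω`. -/
def IsMinimizer (μ : Measure X) (u : X → ℝ) (Ω : Set X) : Prop :=
  MemBVloc μ u Ω ∧ ∀ φ : X → ℝ, MemBVc μ φ Ω →
    tvs μ u (tsupport φ) ≤ tvs μ (fun y => u y + φ y) (tsupport φ)

/-- `u` is a 1-superminimizer in `Ω`. -/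
def IsSuperminimizer (μ : Measure X) (u : X → ℝ) (Ω : Set X) : Prop :=
  MemBVloc μ u Ω ∧ ∀ φ : X → ℝ, MemBVc μ φ Ω → (∀ x, 0 ≤ φ x) →
    tvs μ u (tsupport φ) ≤ tvs μ (fun y => u y + φ y) (tsupport φ)

/-- `u` is a 1-subminimizer in `Ω`. -/
def IsSubminimizer (μ : Measure X) (u : X → ℝ) (Ω : Set X) : Prop :=
  MemBVloc μ u Ω ∧ ∀ φ : X → ℝ, MemBVc μ φ Ω → (∀ x, φ x ≤ 0) →
    tvs μ u (tsupport φ) ≤ tvs μ (fun y => u y + φ y) (tsupport φ)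

/-- The lower approximate limit `u^∧(x)`, with values in `[-∞,∞]`. -/
def lowerApprox (μ : Measure X) (u : X → ℝ) (x : X) : EReal :=
  sSup ((fun t : ℝ => (t : EReal)) '' {t : ℝ | Filter.Tendsto
    (fun r : ℝ => μ ({y | u y < t} ∩ Metric.ball x r) / μ (Metric.ball x r))
    (𝓝[>] (0 : ℝ)) (𝓝 0)})

/-- The upper approximate limit `u^∨(x)`, with values in `[-∞,∞]`. -/
def upperApprox (μ : Measure X) (u : X → ℝ) (x : X) : EReal :=
  sInf ((fun t : ℝ => (t : EReal)) '' {t : ℝ | Filter.Tendsto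
    (fun r : ℝ => μ ({y | t < u y} ∩ Metric.ball x r) / μ (Metric.ball x r))
    (𝓝[>] (0 : ℝ)) (𝓝 0)})

/-- The upper approximate limit of an extended-real-valued function. -/
def upperApproxE (μ : Measure X) (ψ : X → EReal) (x : X) : EReal :=
  sInf ((fun t : ℝ => (t : EReal)) '' {t : ℝ | Filter.Tendsto
    (fun r : ℝ => μ ({y | (t : EReal) < ψ y} ∩ Metric.ball x r) / μ (Metric.ball x r))
    (𝓝[>] (0 : ℝ)) (𝓝 0)})

/-- The measure-theoretic interior `I_E`. -/
def measInterior (μ : Measure X) (E : Set X) : Set X :=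
  {x : X | Filter.Tendsto (fun r : ℝ => μ (Metric.ball x r \ E) / μ (Metric.ball x r))
    (𝓝[>] (0 : ℝ)) (𝓝 0)}

/-- The measure-theoretic boundary `∂*E`. -/
def measBoundary (μ : Measure X) (E : Set X) : Set X :=
  {x : X | 0 < Filter.limsup (fun r : ℝ => μ (Metric.ball x r ∩ E) / μ (Metric.ball x r))
      (𝓝[>] (0 : ℝ)) ∧
    0 < Filter.limsup (fun r : ℝ => μ (Metric.ball x r \ E) / μ (Metric.ball x r))
      (𝓝[>] (0 : ℝ))}

/-- `A` is 1-thin at `x`. -/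
def IsThinAt (μ : Measure X) (A : Set X) (x : X) : Prop :=
  Filter.Tendsto (fun r : ℝ =>
      ENNReal.ofReal r * vcap1 μ (A ∩ Metric.ball x r) (Metric.ball x (2 * r))
        / μ (Metric.ball x r))
    (𝓝[>] (0 : ℝ)) (𝓝 0)

/-- `U` is 1-finely open. -/
def IsFinelyOpen (μ : Measure X) (U : Set X) : Prop :=
  ∀ x ∈ U, IsThinAt μ Uᶜ x

/-- The class `K_{ψ,f}(Ω)` of admissible functions for the obstacle problem. -/
def MemK (μ : Measure X) (ψ : X → EReal) (f : X → ℝ) (Ω : Set X) (u : X → ℝ) : Prop :=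
  MemBVloc μ u Set.univ ∧ (∀ᵐ x ∂μ, x ∈ Ω → ψ x ≤ (u x : EReal)) ∧
    (∀ᵐ x ∂μ, x ∉ Ω → u x = f x)

/-- `u` is a solution of the `K_{ψ,f}(Ω)`-obstacle problem. -/
def IsObstacleSolution (μ : Measure X) (ψ : X → EReal) (f : X → ℝ) (Ω : Set X)
    (u : X → ℝ) : Prop :=
  MemK μ ψ f Ω u ∧ ∀ v : X → ℝ, MemK μ ψ f Ω v → tv μ u Set.univ ≤ tv μ v Set.univ

/-- The standing assumptions: `(X,d,μ)` is a complete metric space with at least two points,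
`μ` is a doubling measure with constant `Cd`, and `X` supports a `(1,1)`-Poincaré inequality
with constants `CP`, `lam`. -/
structure MMS {X : Type*} [MetricSpace X] [MeasurableSpace X] (μ : Measure X)
    (Cd CP lam : ℝ) : Prop where
  complete : CompleteSpace X
  nontrivial : Nontrivial X
  hCd : 1 ≤ Cd
  hCP : 0 < CP
  hlam : 1 ≤ lam
  doubling : ∀ (x : X) (r : ℝ), 0 < r →
    0 < μ (Metric.ball x (2 * r)) ∧
    μ (Metric.ball x (2 * r)) ≤ ENNReal.ofReal Cd * μ (Metric.ball x r) ∧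
    μ (Metric.ball x r) < ⊤
  poincare : ∀ (x : X) (r : ℝ), 0 < r → ∀ u : X → ℝ, MeasureTheory.LocallyIntegrable u μ →
    ∀ g : X → ℝ≥0∞, Measurable g → IsUpperGradientOn g u Set.univ →
      ∫⁻ y in Metric.ball x r, ENNReal.ofReal |u y - ⨍ z in Metric.ball x r, u z ∂μ| ∂μ ≤
        ENNReal.ofReal (CP * r) * (μ (Metric.ball x r) / μ (Metric.ball x (lam * r))) *
          ∫⁻ y in Metric.ball x (lam * r), g y ∂μ

set_option linter.unusedSectionVars false

lemma Curve.continuousOn (γ : Curve X) : ContinuousOn γ.toFun (Icc 0 1) :=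
  γ.lipschitz.choose_spec.continuousOn

/-- The affine reparametrization on `[0,1]` of the restriction of a curve to `[a,b]`. -/
def Curve.sub (γ : Curve X) (a b : ℝ) (ha : 0 ≤ a) (hab : a < b) (hb : b ≤ 1) : Curve X where
  toFun s := γ.toFun (a + (b - a) * s)
  lipschitz := by
    obtain ⟨K, hK⟩ := γ.lipschitz
    refine ⟨K * Real.toNNReal (b - a), LipschitzOnWith.of_dist_le_mul fun s hs t ht => ?_⟩
    have hmem : ∀ s ∈ Icc (0 : ℝ) 1, a + (b - a) * s ∈ Icc (0 : ℝ) 1 := fun s hs =>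
      ⟨by nlinarith [hs.1, hs.2], by nlinarith [hs.1, hs.2]⟩
    refine (hK.dist_le_mul _ (hmem s hs) _ (hmem t ht)).trans_eq ?_
    have : dist (a + (b - a) * s) (a + (b - a) * t) = (b - a) * dist s t := by
      rw [Real.dist_eq, Real.dist_eq, ← abs_of_pos (sub_pos.2 hab), ← abs_mul,
        abs_of_pos (sub_pos.2 hab)]
      congr 1
      ring
    rw [this]
    rw [NNReal.coe_mul, Real.coe_toNNReal _ (sub_pos.2 hab).le]
    ring

lemma speed_affine (γ : ℝ → X) (a c s : ℝ) (hc : 0 < c) :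
    speed (fun s => γ (a + c * s)) s = ENNReal.ofReal c * speed γ (a + c * s) := by
  unfold speed
  have hmap : Filter.map (fun h : ℝ => c * h) (𝓝[≠] (0 : ℝ)) = 𝓝[≠] (0 : ℝ) := by
    have := (Homeomorph.mulLeft₀ c hc.ne').isEmbedding.map_nhdsWithin_eq {0}ᶜ 0
    rw [image_compl_eq (Homeomorph.mulLeft₀ c hc.ne').bijective, image_singleton] at this
    simpa only [Homeomorph.coe_mulLeft₀, mul_zero] using this
  conv_rhs => rw [← hmap]
  have hlim : limsup (fun h : ℝ => ENNReal.ofReal (dist (γ (a + c * s + h)) (γ (a + c * s)) / |h|))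
      (Filter.map (fun h : ℝ => c * h) (𝓝[≠] (0 : ℝ))) =
      limsup (fun h : ℝ => ENNReal.ofReal
        (dist (γ (a + c * s + c * h)) (γ (a + c * s)) / |c * h|)) (𝓝[≠] (0 : ℝ)) := rfl
  rw [hlim, ← ENNReal.limsup_const_mul_of_ne_top ENNReal.ofReal_ne_top]
  congr 1
  funext h
  rw [← ENNReal.ofReal_mul hc.le, abs_mul, abs_of_pos hc]
  dsimp only
  rw [mul_add, ← add_assoc]
  congr 1
  by_cases hh : h = 0
  · simp [hh]
  · field_simp

lemma curveIntegral_sub (g : X → ℝ≥0∞) (γ : Curve X) (a b : ℝ) (ha : 0 ≤ a) (hab : a < b)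
    (hb : b ≤ 1) :
    curveIntegral g (γ.sub a b ha hab hb) =
      ∫⁻ t in Icc a b, g (γ.toFun t) * speed γ.toFun t := by
  have hc : 0 < b - a := sub_pos.2 hab
  unfold curveIntegral Curve.sub
  simp only [speed_affine _ _ _ _ hc]
  let e : ℝ ≃ᵐ ℝ := ((Homeomorph.mulLeft₀ (b - a) hc.ne').trans
    (Homeomorph.addLeft a)).toMeasurableEquiv
  have he : ∀ s, e s = a + (b - a) * s := fun s => rfl
  have hvol : Measure.map e volume = ENNReal.ofReal (b - a)⁻¹ • (volume : Measure ℝ) := by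
    have h1 : (e : ℝ → ℝ) = (fun s => a + s) ∘ (fun s => (b - a) * s) := rfl
    rw [h1, ← Measure.map_map (measurable_const_add a) (measurable_const_mul (b - a)),
      Real.map_volume_mul_left hc.ne', Measure.map_smul, map_add_left_eq_self,
      abs_of_pos (inv_pos.2 hc)]
  have hpre : e ⁻¹' (Icc a b) = Icc 0 1 := by
    ext s
    simp only [mem_preimage, he, mem_Icc]
    constructor
    · rintro ⟨h1, h2⟩
      exact ⟨by by_contra! h; nlinarith, by by_contra! h; nlinarith⟩
    · rintro ⟨h1, h2⟩
      exact ⟨by nlinarith, by nlinarith⟩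
  have key : ∫⁻ t in Icc a b, (g (γ.toFun t) * speed γ.toFun t) ∂(Measure.map e volume) =
      ∫⁻ s in Icc (0 : ℝ) 1, g (γ.toFun (a + (b - a) * s)) *
        speed γ.toFun (a + (b - a) * s) := by
    rw [MeasurableEquiv.restrict_map, MeasureTheory.lintegral_map_equiv, hpre]
    rfl
  rw [hvol, Measure.restrict_smul, lintegral_smul_measure] at key
  have h2 : ∀ s, g (γ.toFun (a + (b - a) * s)) * (ENNReal.ofReal (b - a) *
      speed γ.toFun (a + (b - a) * s)) = ENNReal.ofReal (b - a) * (g (γ.toFun (a + (b - a) * s)) *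
        speed γ.toFun (a + (b - a) * s)) := fun s => by ring
  simp only [h2]
  rw [lintegral_const_mul' _ _ ENNReal.ofReal_ne_top, ← key, smul_eq_mul, ← mul_assoc,
    ← ENNReal.ofReal_mul hc.le, mul_inv_cancel₀ hc.ne', ENNReal.ofReal_one, one_mul]

/-- The derivative of `u` along a curve is controlled by an upper gradient. -/
lemma IsUpperGradientOn.ae_deriv_le {g : X → ℝ≥0∞} {u : X → ℝ} {W : Set X}
    (hg : IsUpperGradientOn g u W) (hW : IsOpen W) (γ : Curve X)
    (hfin : curveIntegral g γ ≠ ⊤) :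
    ∀ᵐ t ∂(volume.restrict (Icc (0 : ℝ) 1)), γ.toFun t ∈ W →
      ENNReal.ofReal |deriv (u ∘ γ.toFun) t| ≤ g (γ.toFun t) * speed γ.toFun t := by
  set G : ℝ → ℝ≥0∞ := fun t => g (γ.toFun t) * speed γ.toFun t with hG
  obtain ⟨G₁, hG₁m, hG₁le, hG₁eq⟩ :=
    exists_measurable_le_lintegral_eq (volume.restrict (Icc (0 : ℝ) 1)) G
  have hfinG : ∫⁻ t in Icc (0 : ℝ) 1, G₁ t ≠ ⊤ := by rw [← hG₁eq]; exact hfin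
  have hInt : ∀ I : Set ℝ, MeasurableSet I → I ⊆ Icc 0 1 →
      ∫⁻ t in I, G t ≤ ∫⁻ t in I, G₁ t := by
    intro I hI hIs
    have h1 := lintegral_inter_add_sdiff (μ := volume) G (Icc (0 : ℝ) 1) hI
    have h2 := lintegral_inter_add_sdiff (μ := volume) G₁ (Icc (0 : ℝ) 1) hI
    rw [inter_eq_self_of_subset_right hIs] at h1 h2
    have h3 : ∫⁻ t in Icc 0 1 \ I, G₁ t ≤ ∫⁻ t in Icc 0 1 \ I, G t := lintegral_mono hG₁le
    have h4 : ∫⁻ t in Icc 0 1 \ I, G₁ t ≠ ⊤ :=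
      ne_top_of_le_ne_top hfinG (lintegral_mono_set sdiff_subset)
    have h5 : (∫⁻ t in I, G t) + ∫⁻ t in Icc 0 1 \ I, G₁ t ≤
        (∫⁻ t in I, G₁ t) + ∫⁻ t in Icc 0 1 \ I, G₁ t := by
      rw [h2, ← hG₁eq, ← h1]
      gcongr
    exact (ENNReal.add_le_add_iff_right h4).1 h5
  set G₂ : ℝ → ℝ≥0∞ := (Icc (0 : ℝ) 1).indicator G₁ with hG₂
  have hG₂m : Measurable G₂ := hG₁m.indicator measurableSet_Icc
  have hG₂fin : ∫⁻ t, G₂ t ≠ ⊤ := by rwa [hG₂, lintegral_indicator measurableSet_Icc]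
  have hleb := (IsUnifLocDoublingMeasure.vitaliFamily (volume : Measure ℝ) 1).ae_tendsto_lintegral_div
    hG₂m.aemeasurable hG₂fin
  have hne1 : ∀ᵐ t : ℝ, t ≠ 1 := by simp [ae_iff, measure_singleton]
  have hne0 : ∀ᵐ t : ℝ, t ≠ 0 := by simp [ae_iff, measure_singleton]
  rw [ae_restrict_iff' measurableSet_Icc]
  filter_upwards [hleb, hne1, hne0] with t ht ht1 ht0 htI htW
  by_cases hd : DifferentiableAt ℝ (u ∘ γ.toFun) t
  swap
  · simp [deriv_zero_of_not_differentiableAt hd]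
  have htlt : t < 1 := lt_of_le_of_ne htI.2 ht1
  have htpos : 0 < t := lt_of_le_of_ne htI.1 (Ne.symm ht0)
  have hcont : ContinuousAt γ.toFun t := γ.continuousOn.continuousAt (Icc_mem_nhds htpos htlt)
  obtain ⟨ε, hε, hball⟩ := Metric.mem_nhds_iff.1 (hcont (hW.mem_nhds htW))
  have hlim1 := ht.comp (Real.tendsto_Icc_vitaliFamily_right t)
  have hlim2 : Tendsto (fun y => ENNReal.ofReal |slope (u ∘ γ.toFun) t y|) (𝓝[>] t)
      (𝓝 (ENNReal.ofReal |deriv (u ∘ γ.toFun) t|)) := by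
    refine ENNReal.tendsto_ofReal (Tendsto.abs ?_)
    exact (hasDerivAt_iff_tendsto_slope.1 hd.hasDerivAt).mono_left
      (nhdsWithin_mono _ fun y hy => ne_of_gt hy)
  have hle : ENNReal.ofReal |deriv (u ∘ γ.toFun) t| ≤ G₂ t := by
    refine le_of_tendsto_of_tendsto hlim2 hlim1 ?_
    filter_upwards [Ioo_mem_nhdsGT (show t < min (t + ε) 1 from lt_min (by linarith) htlt)]
      with y hy
    have hy1 : y < 1 := lt_of_lt_of_le hy.2 (min_le_right _ _)
    have hyε : y < t + ε := lt_of_lt_of_le hy.2 (min_le_left _ _)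
    have hty : t < y := hy.1
    have hin : (γ.sub t y htpos.le hty hy1.le).In W := by
      intro s hs
      refine hball (?_ : _ ∈ Metric.ball t ε)
      rw [Metric.mem_ball, Real.dist_eq, abs_lt]
      constructor <;> nlinarith [hs.1, hs.2]
    have := hg _ hin
    rw [curveIntegral_sub] at this
    have e1 : (γ.sub t y htpos.le hty hy1.le).toFun 1 = γ.toFun y := by
      simp [Curve.sub]
    have e0 : (γ.sub t y htpos.le hty hy1.le).toFun 0 = γ.toFun t := by
      simp [Curve.sub]
    rw [e1, e0] at this
    have hsub : Icc t y ⊆ Icc (0 : ℝ) 1 := Icc_subset_Icc htpos.le hy1.le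
    have h3 : ∫⁻ s in Icc t y, G₁ s = ∫⁻ s in Icc t y, G₂ s :=
      setLIntegral_congr_fun measurableSet_Icc fun s hs => by
        rw [hG₂, indicator_of_mem (hsub hs)]
    have h4 := (this.trans (hInt _ measurableSet_Icc hsub)).trans_eq h3
    simp only [Function.comp_apply, Real.volume_Icc]
    rw [ENNReal.le_div_iff_mul_le (Or.inl (by simp [hty])) (Or.inl (by simp)),
      ← ENNReal.ofReal_mul (abs_nonneg _)]
    refine le_trans (le_of_eq ?_) h4
    congr 1
    rw [slope_def_field, abs_div, abs_of_pos (sub_pos.2 hty), div_mul_cancel₀]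
    · rfl
    · exact (sub_pos.2 hty).ne'
  refine hle.trans ?_
  rw [hG₂, indicator_of_mem htI]
  exact hG₁le t

lemma ofReal_abs_sub_le_lintegral_deriv {f : ℝ → ℝ} {K : ℝ≥0}
    (hf : LipschitzOnWith K f (Icc 0 1)) :
    ENNReal.ofReal |f 1 - f 0| ≤ ∫⁻ t in Icc (0 : ℝ) 1, ENNReal.ofReal |deriv f t| := by
  have hac : AbsolutelyContinuousOnInterval f 0 1 :=
    LipschitzOnWith.absolutelyContinuousOnInterval (K := K) (by simpa using hf)
  have hInt := hac.intervalIntegrable_deriv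
  rw [intervalIntegrable_iff_integrableOn_Icc_of_le zero_le_one] at hInt
  rw [← hac.integral_deriv_eq_sub, intervalIntegral.integral_of_le zero_le_one,
    ← integral_Icc_eq_integral_Ioc]
  refine (ENNReal.ofReal_le_ofReal (norm_integral_le_integral_norm (deriv f))).trans ?_
  rw [ofReal_integral_norm_eq_lintegral_enorm hInt]
  simp [Real.enorm_eq_ofReal_abs]

lemma ofReal_abs_deriv_comp_le {η : X → ℝ} {L : ℝ≥0} (hη : LipschitzWith L η) (γ : ℝ → X) (t : ℝ) :
    ENNReal.ofReal |deriv (η ∘ γ) t| ≤ L * speed γ t := by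
  by_cases hd : DifferentiableAt ℝ (η ∘ γ) t
  swap
  · simp [deriv_zero_of_not_differentiableAt hd]
  have hslope : Tendsto (fun h : ℝ => h⁻¹ • ((η ∘ γ) (t + h) - (η ∘ γ) t))
      (𝓝[≠] 0) (𝓝 (deriv (η ∘ γ) t)) := hasDerivAt_iff_tendsto_slope_zero.1 hd.hasDerivAt
  have hlim : Tendsto (fun h : ℝ => ENNReal.ofReal |h⁻¹ • ((η ∘ γ) (t + h) - (η ∘ γ) t)|)
      (𝓝[≠] 0) (𝓝 (ENNReal.ofReal |deriv (η ∘ γ) t|)) :=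
    ENNReal.tendsto_ofReal (Tendsto.abs hslope)
  rw [← hlim.limsup_eq, speed, ← ENNReal.limsup_const_mul_of_ne_top ENNReal.coe_ne_top]
  refine limsup_le_limsup (Eventually.of_forall fun h => ?_)
  simp only [smul_eq_mul, abs_mul, abs_inv, Function.comp_apply]
  rw [← ENNReal.ofReal_coe_nnreal, ← ENNReal.ofReal_mul L.coe_nonneg]
  refine ENNReal.ofReal_le_ofReal ?_
  have := hη.dist_le_mul (γ (t + h)) (γ t)
  rw [Real.dist_eq] at this
  rw [inv_mul_eq_div, ← mul_div_assoc]
  gcongr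

lemma LocLipschitzOn.comp_curve {v : X → ℝ} {W : Set X} (hv : LocLipschitzOn v W) {γ : Curve X}
    (hγ : γ.In W) : ∃ K : ℝ≥0, LipschitzOnWith K (v ∘ γ.toFun) (Icc 0 1) := by
  obtain ⟨K, hK⟩ := γ.lipschitz
  obtain ⟨L, hL⟩ := hv (γ.toFun '' Icc 0 1) (isCompact_Icc.image_of_continuousOn γ.continuousOn)
    (by rintro _ ⟨t, ht, rfl⟩; exact hγ t ht)
  exact ⟨L * K, hL.comp hK (mapsTo_image _ _)⟩

lemma ae_differentiableAt_of_lipschitzOn_Icc {f : ℝ → ℝ} {K : ℝ≥0}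
    (hf : LipschitzOnWith K f (Icc 0 1)) :
    ∀ᵐ t ∂(volume.restrict (Icc (0 : ℝ) 1)), DifferentiableAt ℝ f t := by
  have hd := hf.ae_differentiableWithinAt_real measurableSet_Icc
  rw [ae_restrict_iff' measurableSet_Icc] at hd ⊢
  have hne1 : ∀ᵐ t : ℝ, t ≠ 1 := by simp [ae_iff, measure_singleton]
  have hne0 : ∀ᵐ t : ℝ, t ≠ 0 := by simp [ae_iff, measure_singleton]
  filter_upwards [hd, hne1, hne0] with t ht h1 h0 hI
  exact (ht hI).differentiableAt
    (Icc_mem_nhds (lt_of_le_of_ne hI.1 (Ne.symm h0)) (lt_of_le_of_ne hI.2 h1))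

lemma ofReal_abs_sub_le_curveIntegral {v : X → ℝ} {h : X → ℝ≥0∞} {γ : Curve X} {K : ℝ≥0}
    (hv : LipschitzOnWith K (v ∘ γ.toFun) (Icc 0 1))
    (hd : ∀ᵐ t ∂(volume.restrict (Icc (0 : ℝ) 1)),
      ENNReal.ofReal |deriv (v ∘ γ.toFun) t| ≤ h (γ.toFun t) * speed γ.toFun t) :
    ENNReal.ofReal |v (γ.toFun 1) - v (γ.toFun 0)| ≤ curveIntegral h γ :=
  (ofReal_abs_sub_le_lintegral_deriv hv).trans (lintegral_mono_ae hd)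

lemma mod1_setOf_curveIntegral_eq_top (μ : Measure X) {g : X → ℝ≥0∞} (hg : Measurable g)
    (hfin : ∫⁻ x, g x ∂μ ≠ ⊤) : Mod1 μ {γ : Curve X | curveIntegral g γ = ⊤} = 0 := by
  refine le_antisymm (le_of_forall_gt fun c hc => ?_) zero_le
  obtain ⟨ε, hε0, hε⟩ : ∃ ε : ℝ≥0, 0 < ε ∧ ε * ∫⁻ x, g x ∂μ < c := by
    have : Tendsto (fun ε : ℝ≥0 => (ε : ℝ≥0∞) * ∫⁻ x, g x ∂μ) (𝓝[>] 0) (𝓝 0) := by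
      have h := ENNReal.Tendsto.mul_const (b := ∫⁻ x, g x ∂μ)
        (ENNReal.tendsto_coe.2 (tendsto_id (α := ℝ≥0) (x := 𝓝 0))) (Or.inr hfin)
      simp only [id, ENNReal.coe_zero, zero_mul] at h
      exact h.mono_left nhdsWithin_le_nhds
    obtain ⟨ε, h1, h2⟩ := ((this.eventually (gt_mem_nhds hc)).and self_mem_nhdsWithin).exists
    exact ⟨ε, h2, h1⟩
  refine lt_of_le_of_lt ?_ hε
  refine (iInf₂_le (fun x => ε * g x) (hg.const_mul _)).trans ?_
  refine (iInf_le _ ?_).trans (lintegral_const_mul _ hg).le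
  intro γ hγ
  have : (ε : ℝ≥0∞) * curveIntegral g γ ≤ curveIntegral (fun x => ε * g x) γ := by
    refine (lintegral_const_mul_le _ _).trans (le_of_eq ?_)
    simp only [curveIntegral, mul_assoc]
  rw [hγ, ENNReal.mul_top (by exact_mod_cast hε0.ne')] at this
  exact le_trans le_top this

/-- A criterion for weak upper gradients in terms of derivatives along curves. -/
lemma isWeakUpperGradientOn_of_deriv (μ : Measure X) {W : Set X} {g h : X → ℝ≥0∞} {v : X → ℝ}
    (hg : Measurable g) (hfin : ∫⁻ x, g x ∂μ ≠ ⊤) (hv : LocLipschitzOn v W)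
    (hd : ∀ γ : Curve X, γ.In W → curveIntegral g γ ≠ ⊤ →
      ∀ᵐ t ∂(volume.restrict (Icc (0 : ℝ) 1)),
        ENNReal.ofReal |deriv (v ∘ γ.toFun) t| ≤ h (γ.toFun t) * speed γ.toFun t) :
    IsWeakUpperGradientOn μ h v W := by
  refine ⟨_, mod1_setOf_curveIntegral_eq_top μ hg hfin, fun γ hγ hγW => ?_⟩
  obtain ⟨K, hK⟩ := hv.comp_curve hγW
  exact ofReal_abs_sub_le_curveIntegral hK (hd γ hγW hγ)

/-- A weak upper gradient can be corrected to an upper gradient by a function of small integral. -/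
lemma IsWeakUpperGradientOn.exists_isUpperGradientOn {μ : Measure X} {g : X → ℝ≥0∞} {u : X → ℝ}
    {W : Set X} (hgm : Measurable g) (hg : IsWeakUpperGradientOn μ g u W) {ε : ℝ≥0∞}
    (hε : ε ≠ 0) :
    ∃ g' : X → ℝ≥0∞, Measurable g' ∧ IsUpperGradientOn g' u W ∧
      ∫⁻ x in W, g' x ∂μ ≤ ∫⁻ x in W, g x ∂μ + ε := by
  obtain ⟨Γ, hΓ, hug⟩ := hg
  obtain ⟨ε', hε'0, hε'⟩ := ENNReal.exists_pos_sum_of_countable' hε ℕ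
  have hρ : ∀ n : ℕ, ∃ ρ : X → ℝ≥0∞, Measurable ρ ∧ (∀ γ ∈ Γ, 1 ≤ curveIntegral ρ γ) ∧
      ∫⁻ x, ρ x ∂μ < ε' n := by
    intro n
    have h : Mod1 μ Γ < ε' n := by rw [hΓ]; exact hε'0 n
    unfold Mod1 at h
    simp only [iInf_lt_iff] at h
    obtain ⟨ρ, h1, h2, h3⟩ := h
    exact ⟨ρ, h1, h2, h3⟩
  choose ρ hρm hρΓ hρε using hρ
  refine ⟨fun x => g x + ∑' n, ρ n x, hgm.add (Measurable.tsum hρm), fun γ hγ => ?_, ?_⟩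
  · by_cases hγΓ : γ ∈ Γ
    · have htop : curveIntegral (fun x => g x + ∑' n, ρ n x) γ = ⊤ := by
        refine ENNReal.eq_top_of_forall_nnreal_le fun r => ?_
        obtain ⟨N, hN⟩ := exists_nat_ge r
        have hfin : ∀ N : ℕ, (N : ℝ≥0∞) ≤
            curveIntegral (fun x => ∑ n ∈ Finset.range N, ρ n x) γ := by
          intro N
          induction N with
          | zero => simp
          | succ k ih =>
            simp only [Finset.sum_range_succ, curveIntegral, add_mul]
            push_cast
            refine le_trans (add_le_add ih (hρΓ k γ hγΓ)) ?_
            exact le_lintegral_add _ _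
        refine le_trans (by exact_mod_cast hN) ((hfin N).trans (lintegral_mono fun t => ?_))
        dsimp only
        gcongr
        exact (ENNReal.sum_le_tsum _).trans le_add_self
      rw [htop]
      exact le_top
    · exact (hug γ hγΓ hγ).trans (lintegral_mono fun t => by dsimp only; gcongr; exact le_self_add)
  · rw [lintegral_add_left hgm]
    gcongr
    refine (setLIntegral_le_lintegral _ _).trans ?_
    rw [lintegral_tsum fun n => (hρm n).aemeasurable]
    exact (ENNReal.tsum_le_tsum fun n => (hρε n).le).trans hε'.le

section Doubling

variable [BorelSpace X] {μ : Measure X} {Cd CP lam : ℝ}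

lemma MMS.measure_ball_pos (hX : MMS μ Cd CP lam) (x : X) {r : ℝ} (hr : 0 < r) :
    0 < μ (ball x r) := by
  have := (hX.doubling x (r / 2) (by linarith)).1
  rwa [mul_div_cancel₀ _ two_ne_zero] at this

lemma MMS.measure_ball_lt_top (hX : MMS μ Cd CP lam) (x : X) (r : ℝ) : μ (ball x r) < ⊤ := by
  rcases le_or_gt r 0 with hr | hr
  · simp [ball_eq_empty.2 hr]
  · exact (hX.doubling x r hr).2.2

lemma MMS.measure_ball_pow_le (hX : MMS μ Cd CP lam) (x : X) {r : ℝ} (hr : 0 < r) (n : ℕ) :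
    μ (ball x (2 ^ n * r)) ≤ ENNReal.ofReal Cd ^ n * μ (ball x r) := by
  induction n with
  | zero => simp
  | succ n ih =>
    have h := (hX.doubling x (2 ^ n * r) (by positivity)).2.1
    rw [pow_succ', mul_assoc, pow_succ' (ENNReal.ofReal Cd), mul_assoc]
    exact h.trans (by gcongr)

lemma MMS.card_le_of_separated (hX : MMS μ Cd CP lam) {z : X} {r : ℝ} (hr : 0 < r) (n : ℕ)
    (F : Finset X) (hF : ∀ y ∈ F, dist y z < 2 ^ n * r)
    (hsep : ∀ y ∈ F, ∀ y' ∈ F, y ≠ y' → r ≤ dist y y') :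
    (F.card : ℝ≥0∞) ≤ ENNReal.ofReal Cd ^ (n + 3) := by
  have h1n : (1 : ℝ) ≤ 2 ^ n := one_le_pow₀ one_le_two
  have hdisj : (F : Set X).PairwiseDisjoint fun y => ball y (r / 2) := by
    intro y hy y' hy' hne
    exact ball_disjoint_ball (by linarith [hsep y hy y' hy' hne])
  have hsub : (⋃ y ∈ F, ball y (r / 2)) ⊆ ball z (2 ^ (n + 1) * r) := by
    refine iUnion₂_subset fun y hy => ball_subset_ball' ?_
    have := hF y hy
    rw [pow_succ]
    nlinarith
  have hsum : ∑ y ∈ F, μ (ball y (r / 2)) ≤ μ (ball z (2 ^ (n + 1) * r)) := by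
    rw [← measure_biUnion_finset hdisj fun y _ => measurableSet_ball]
    exact measure_mono hsub
  have heach : ∀ y ∈ F, μ (ball z (2 ^ (n + 1) * r)) ≤
      ENNReal.ofReal Cd ^ (n + 3) * μ (ball y (r / 2)) := by
    intro y hy
    refine le_trans (measure_mono (ball_subset_ball' ?_))
      (hX.measure_ball_pow_le y (by linarith : 0 < r / 2) (n + 3))
    have := hF y hy
    rw [dist_comm] at this
    have e : (2 : ℝ) ^ (n + 3) * (r / 2) = 2 ^ (n + 1) * r + 2 ^ (n + 1) * r := by ring
    rw [e, pow_succ]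
    nlinarith
  have hpos := hX.measure_ball_pos z (show 0 < 2 ^ (n + 1) * r by positivity)
  have hfin := hX.measure_ball_lt_top z (2 ^ (n + 1) * r)
  have : (F.card : ℝ≥0∞) * μ (ball z (2 ^ (n + 1) * r)) ≤
      ENNReal.ofReal Cd ^ (n + 3) * μ (ball z (2 ^ (n + 1) * r)) := by
    calc (F.card : ℝ≥0∞) * μ (ball z (2 ^ (n + 1) * r))
        = ∑ y ∈ F, μ (ball z (2 ^ (n + 1) * r)) := by simp
      _ ≤ ∑ y ∈ F, ENNReal.ofReal Cd ^ (n + 3) * μ (ball y (r / 2)) := Finset.sum_le_sum heach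
      _ = ENNReal.ofReal Cd ^ (n + 3) * ∑ y ∈ F, μ (ball y (r / 2)) := by rw [Finset.mul_sum]
      _ ≤ _ := by gcongr
  exact (ENNReal.mul_le_mul_iff_left hpos.ne' hfin.ne).1 this

/-- Bounded sets are covered by finitely many balls of a given radius with bounded overlap. -/
lemma MMS.exists_cover (hX : MMS μ Cd CP lam) {A : Set X} {x : X} {R r : ℝ} (hr : 0 < r)
    (hA : A ⊆ ball x R) :
    ∃ F : Finset X, (∀ y ∈ F, y ∈ A) ∧ (A ⊆ ⋃ y ∈ F, ball y r) ∧
      ∀ (n : ℕ) (z : X), ∀ F' ⊆ F, (∀ y ∈ F', z ∈ ball y (2 ^ n * r)) →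
        (F'.card : ℝ≥0∞) ≤ ENNReal.ofReal Cd ^ (n + 3) := by
  obtain ⟨n, hn⟩ : ∃ n : ℕ, R / r < 2 ^ n := pow_unbounded_of_one_lt _ one_lt_two
  have hn' : R < 2 ^ n * r := by rwa [div_lt_iff₀ hr] at hn
  let P : Finset X → Prop := fun F => (∀ y ∈ F, y ∈ A) ∧
    ∀ y ∈ F, ∀ y' ∈ F, y ≠ y' → r ≤ dist y y'
  have hbdd : BddAbove {k | ∃ F, P F ∧ F.card = k} := by
    obtain ⟨N, hN⟩ := ENNReal.exists_nat_gt
      (show ENNReal.ofReal Cd ^ (n + 3) ≠ ⊤ from ENNReal.pow_ne_top ENNReal.ofReal_ne_top)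
    refine ⟨N, ?_⟩
    rintro _ ⟨F, hF, rfl⟩
    have := hX.card_le_of_separated hr n F
      (fun y hy => (mem_ball.1 (hA (hF.1 y hy))).trans hn') hF.2
    exact_mod_cast this.trans hN.le
  obtain ⟨F, hF, hcard⟩ := Nat.sSup_mem (s := {k | ∃ F, P F ∧ F.card = k})
    ⟨0, ∅, by simp [P], by simp⟩ hbdd
  refine ⟨F, hF.1, fun y hy => ?_, fun m z F' hF' hz => ?_⟩
  · by_contra hcon
    simp only [mem_iUnion, mem_ball, not_exists, not_lt] at hcon
    have hyF : y ∉ F := fun h => by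
      have := hcon y h
      rw [dist_self] at this
      linarith
    have hP : P (Finset.cons y F hyF) := by
      refine ⟨fun p hp => ?_, fun p hp q hq hpq => ?_⟩
      · rcases Finset.mem_cons.1 hp with rfl | hp
        exacts [hy, hF.1 p hp]
      · rcases Finset.mem_cons.1 hp with rfl | hp' <;> rcases Finset.mem_cons.1 hq with rfl | hq'
        · exact absurd rfl hpq
        · exact hcon q hq'
        · rw [dist_comm]; exact hcon p hp'
        · exact hF.2 p hp' q hq' hpq
    have := le_csSup hbdd ⟨_, hP, rfl⟩
    rw [Finset.card_cons, ← hcard] at this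
    omega
  · refine hX.card_le_of_separated (z := z) hr m F' (fun y hy => ?_)
      (fun y hy y' hy' => hF.2 y (hF' hy) y' (hF' hy'))
    have := hz y hy
    rwa [mem_ball, dist_comm] at this

lemma MMS.properSpace (hX : MMS μ Cd CP lam) : ProperSpace X := by
  have := hX.complete
  refine ⟨fun x R => isCompact_iff_totallyBounded_isComplete.2
    ⟨?_, isClosed_closedBall.isComplete⟩⟩
  rw [Metric.totallyBounded_iff]
  intro ε hε
  obtain ⟨F, -, hF, -⟩ := hX.exists_cover (A := closedBall x R) (x := x) (R := R + 1) hε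
    (closedBall_subset_ball (by linarith))
  exact ⟨F, F.finite_toSet, by simpa using hF⟩

lemma MMS.isLocallyFiniteMeasure (hX : MMS μ Cd CP lam) : IsLocallyFiniteMeasure μ :=
  ⟨fun x => ⟨ball x 1, ball_mem_nhds x one_pos, hX.measure_ball_lt_top x 1⟩⟩

end Doubling

lemma LocLipschitzOn.continuousOn_of_isCompact {v : X → ℝ} {W K : Set X} (hv : LocLipschitzOn v W)
    (hK : IsCompact K) (hKW : K ⊆ W) : ContinuousOn v K :=
  (hv K hK hKW).choose_spec.continuousOn

lemma LocLipschitzOn.mono {v : X → ℝ} {W W' : Set X} (hv : LocLipschitzOn v W) (h : W' ⊆ W) :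
    LocLipschitzOn v W' := fun K hK hKW => hv K hK (hKW.trans h)

lemma TendstoL1Loc.mono {μ : Measure X} {v : ℕ → X → ℝ} {u : X → ℝ} {W W' : Set X}
    (hv : TendstoL1Loc μ v u W) (h : W' ⊆ W) : TendstoL1Loc μ v u W' :=
  fun K hK hKW => hv K hK (hKW.trans h)

lemma IsUpperGradientOn.mono {g : X → ℝ≥0∞} {v : X → ℝ} {W W' : Set X}
    (hg : IsUpperGradientOn g v W) (h : W' ⊆ W) : IsUpperGradientOn g v W' :=
  fun γ hγ => hg γ fun t ht => h (hγ t ht)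

lemma IsWeakUpperGradientOn.mono {μ : Measure X} {g : X → ℝ≥0∞} {v : X → ℝ} {W W' : Set X}
    (hg : IsWeakUpperGradientOn μ g v W) (h : W' ⊆ W) : IsWeakUpperGradientOn μ g v W' := by
  obtain ⟨Γ, hΓ, hug⟩ := hg
  exact ⟨Γ, hΓ, fun γ hγ hW => hug γ hγ fun t ht => h (hW t ht)⟩

lemma tv_le_liminf {μ : Measure X} {u : X → ℝ} {W : Set X} {v : ℕ → X → ℝ} {g : ℕ → X → ℝ≥0∞}
    (hv : ∀ i, LocLipschitzOn (v i) W) (hconv : TendstoL1Loc μ v u W)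
    (hgm : ∀ i, Measurable (g i)) (hg : ∀ i, IsWeakUpperGradientOn μ (g i) (v i) W) :
    tv μ u W ≤ liminf (fun i => ∫⁻ x in W, g i x ∂μ) atTop :=
  (iInf₂_le v hv).trans ((iInf₂_le hconv g).trans (iInf₂_le hgm hg))

lemma tv_mono {μ : Measure X} {u : X → ℝ} {W W' : Set X} (h : W' ⊆ W) :
    tv μ u W' ≤ tv μ u W := by
  refine le_iInf₂ fun v hv => le_iInf₂ fun hconv g => le_iInf₂ fun hgm hg => ?_
  refine (tv_le_liminf (fun i => (hv i).mono h) (hconv.mono h) hgm fun i => (hg i).mono h).trans ?_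
  exact liminf_le_liminf (Eventually.of_forall fun i => lintegral_mono_set h)

/-- Approximating sequences for the total variation may be taken with genuine upper gradients that
vanish outside the open set, and with uniformly controlled integrals. -/
lemma exists_seq_of_tv_lt [BorelSpace X] {μ : Measure X} {u : X → ℝ} {W : Set X} (hW : IsOpen W)
    {c : ℝ≥0∞} (h : tv μ u W < c) :
    ∃ (v : ℕ → X → ℝ) (g : ℕ → X → ℝ≥0∞), (∀ i, LocLipschitzOn (v i) W) ∧
      TendstoL1Loc μ v u W ∧ (∀ i, Measurable (g i)) ∧ (∀ i, IsUpperGradientOn (g i) (v i) W) ∧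
      (∀ i, ∫⁻ x in W, g i x ∂μ < c) ∧ ∀ i, ∫⁻ x, g i x ∂μ = ∫⁻ x in W, g i x ∂μ := by
  unfold tv at h
  simp only [iInf_lt_iff] at h
  obtain ⟨v, hv, hconv, g, hgm, hg, hlim⟩ := h
  obtain ⟨c', hc', hc'c⟩ := exists_between hlim
  obtain ⟨φ, hφ, hφc⟩ := extraction_of_frequently_atTop
    (frequently_lt_of_liminf_lt (by isBoundedDefault) hc')
  set ε : ℝ≥0∞ := min 1 (c - c') with hεdef
  have hε : ε ≠ 0 := (lt_min one_pos (tsub_pos_of_lt hc'c)).ne'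
  have hεtop : ε ≠ ⊤ := ((min_le_left _ _).trans_lt ENNReal.one_lt_top).ne
  have hex := fun i => (hg (φ i)).exists_isUpperGradientOn (hgm (φ i)) hε
  choose g' hg'm hg' hg'le using hex
  have hres : ∀ i, ∫⁻ x in W, W.indicator (g' i) x ∂μ = ∫⁻ x in W, g' i x ∂μ := fun i =>
    setLIntegral_congr_fun hW.measurableSet fun x hx => by rw [indicator_of_mem hx]
  refine ⟨fun i => v (φ i), fun i => W.indicator (g' i), fun i => hv _,
    fun K hK hKW => (hconv K hK hKW).comp hφ.tendsto_atTop,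
    fun i => (hg'm i).indicator hW.measurableSet, fun i γ hγ => ?_, fun i => ?_, fun i => ?_⟩
  · refine (hg' i γ hγ).trans_eq ?_
    unfold curveIntegral
    refine setLIntegral_congr_fun measurableSet_Icc fun t ht => ?_
    dsimp only
    rw [indicator_of_mem (hγ t ht)]
  · rw [hres]
    calc ∫⁻ x in W, g' i x ∂μ ≤ ∫⁻ x in W, g (φ i) x ∂μ + ε := hg'le i
      _ < c' + ε := (ENNReal.add_lt_add_iff_right hεtop).2 (hφc i)
      _ ≤ c' + (c - c') := by gcongr; exact min_le_right _ _
      _ = c := add_tsub_cancel_of_le hc'c.le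
  · rw [hres, lintegral_indicator hW.measurableSet]

/-- The radial cutoff function, equal to `1` on `closedBall x s` and to `0` outside `ball x S`. -/
def cutoff (x : X) (s S : ℝ) (z : X) : ℝ := min 1 (max 0 ((S - dist z x) / (S - s)))

lemma cutoff_nonneg (x : X) (s S : ℝ) (z : X) : 0 ≤ cutoff x s S z :=
  le_min zero_le_one (le_max_left _ _)

lemma cutoff_le_one (x : X) (s S : ℝ) (z : X) : cutoff x s S z ≤ 1 := min_le_left _ _

lemma cutoff_eq_one {x : X} {s S : ℝ} (h : s < S) {z : X} (hz : dist z x ≤ s) :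
    cutoff x s S z = 1 := by
  refine min_eq_left (le_max_of_le_right ?_)
  rw [one_le_div (by linarith)]
  linarith

lemma cutoff_pos {x : X} {s S : ℝ} (h : s < S) {z : X} (hz : dist z x < S) :
    0 < cutoff x s S z :=
  lt_min one_pos (lt_max_of_lt_right (div_pos (by linarith) (by linarith)))

lemma cutoff_eq_zero {x : X} {s S : ℝ} (h : s < S) {z : X} (hz : S ≤ dist z x) :
    cutoff x s S z = 0 := by
  have : (S - dist z x) / (S - s) ≤ 0 := div_nonpos_of_nonpos_of_nonneg (by linarith) (by linarith)
  simp [cutoff, max_eq_left this]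

lemma lipschitzWith_cutoff {x : X} {s S : ℝ} (h : s < S) :
    LipschitzWith (Real.toNNReal (1 / (S - s))) (cutoff x s S) := by
  have h1 : LipschitzWith (Real.toNNReal (1 / (S - s))) fun z => (S - dist z x) / (S - s) := by
    refine LipschitzWith.of_dist_le_mul fun z z' => ?_
    rw [Real.coe_toNNReal _ (by have := sub_pos.2 h; positivity), Real.dist_eq, ← sub_div, abs_div,
      abs_of_pos (sub_pos.2 h), one_div, inv_mul_eq_div]
    have := sub_pos.2 h
    gcongr
    have h2 := abs_dist_sub_le z z' x
    rw [abs_sub_comm] at h2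
    calc |S - dist z x - (S - dist z' x)| = |dist z' x - dist z x| := by congr 1; ring
      _ ≤ _ := h2
  exact (h1.const_max 0).const_min 1

lemma lipschitzWith_mul_of_eq_zero_off {K : Set X} (hK : IsCompact K) {w η : X → ℝ} {L L' : ℝ≥0}
    (hw : LipschitzOnWith L w K) (hη : LipschitzWith L' η) (h1 : ∀ z, |η z| ≤ 1)
    (h0 : ∀ z ∉ K, η z = 0) : ∃ C : ℝ≥0, LipschitzWith C fun z => η z * w z := by
  obtain ⟨M, hM⟩ := hK.exists_bound_of_continuousOn hw.continuousOn
  have hM' : ∀ z ∈ K, |w z| ≤ max M 0 := fun z hz => (hM z hz).trans (le_max_left _ _)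
  have hM0 : 0 ≤ max M 0 := le_max_right _ _
  have hηd : ∀ z z', |η z - η z'| ≤ L' * dist z z' := fun z z' => by
    simpa [Real.dist_eq] using hη.dist_le_mul z z'
  have hout : ∀ z ∈ K, ∀ z' ∉ K, |η z * w z| ≤ L' * dist z z' * max M 0 := by
    intro z hz z' hz'
    have := hηd z z'
    rw [h0 z' hz', sub_zero] at this
    rw [abs_mul]
    exact mul_le_mul this (hM' z hz) (abs_nonneg _) (by positivity)
  refine ⟨L' * (max M 0).toNNReal + L, LipschitzWith.of_dist_le_mul fun z z' => ?_⟩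
  rw [NNReal.coe_add, NNReal.coe_mul, Real.coe_toNNReal _ hM0, Real.dist_eq]
  have hL : 0 ≤ (L : ℝ) * dist z z' := by positivity
  by_cases hz : z ∈ K <;> by_cases hz' : z' ∈ K
  · have e : η z * w z - η z' * w z' = (η z - η z') * w z + η z' * (w z - w z') := by ring
    have hwd := hw.dist_le_mul z hz z' hz'
    rw [Real.dist_eq] at hwd
    calc |η z * w z - η z' * w z'| ≤ |η z - η z'| * |w z| + |η z'| * |w z - w z'| := by
          rw [e, ← abs_mul, ← abs_mul]; exact abs_add_le _ _
      _ ≤ (L' * dist z z') * max M 0 + 1 * (L * dist z z') := by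
          gcongr
          exacts [hηd z z', hM' z hz, h1 z']
      _ = _ := by ring
  · rw [h0 z' hz', zero_mul, sub_zero]
    nlinarith [hout z hz z' hz']
  · rw [h0 z hz, zero_mul, zero_sub, abs_neg, dist_comm]
    rw [dist_comm] at hL
    nlinarith [hout z' hz' z hz]
  · rw [h0 z hz, h0 z' hz']
    simp only [zero_mul, sub_self, abs_zero]
    positivity

lemma lintegral_abs_le_of_vanishing {μ : Measure X} {v w : X → ℝ} {B : Set X} (hμB : μ B ≠ ⊤)
    (hv : AEMeasurable v (μ.restrict B)) (hw : AEMeasurable w (μ.restrict B)) (h : 2 * μ ({z | w z ≠ 0} ∩ B) ≤ μ B) (m : ℝ) :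
    ∫⁻ z in B, ENNReal.ofReal |w z| ∂μ ≤ 3 * (∫⁻ z in B, ENNReal.ofReal |v z - m| ∂μ +
      ∫⁻ z in B, ENNReal.ofReal |v z - w z| ∂μ) := by
  set Z := {z | w z = 0} ∩ B with hZ
  set P := ∫⁻ z in B, ENNReal.ofReal |v z - m| ∂μ
  set e := ∫⁻ z in B, ENNReal.ofReal |v z - w z| ∂μ
  have hvm : AEMeasurable (fun z => ENNReal.ofReal |v z - m|) (μ.restrict B) := by fun_prop
  have hμZ : μ B ≤ 2 * μ Z := by
    have h1 : μ B ≤ μ ({z | w z ≠ 0} ∩ B) + μ Z := by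
      refine (measure_mono fun z hz => ?_).trans (measure_union_le _ _)
      by_cases hw : w z = 0
      exacts [Or.inr ⟨hw, hz⟩, Or.inl ⟨hw, hz⟩]
    have h2 : μ B + μ B ≤ μ B + 2 * μ Z := by
      calc μ B + μ B ≤ 2 * (μ ({z | w z ≠ 0} ∩ B) + μ Z) := by rw [← two_mul]; gcongr
        _ = 2 * μ ({z | w z ≠ 0} ∩ B) + 2 * μ Z := mul_add _ _ _
        _ ≤ μ B + 2 * μ Z := by gcongr
    exact (ENNReal.add_le_add_iff_left hμB).1 h2
  have hmZ : ENNReal.ofReal |m| * μ Z ≤ P + e := by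
    calc ENNReal.ofReal |m| * μ Z = ∫⁻ _ in Z, ENNReal.ofReal |m| ∂μ := by rw [setLIntegral_const]
      _ ≤ ∫⁻ z in Z, (ENNReal.ofReal |v z - m| + ENNReal.ofReal |v z - w z|) ∂μ := by
        have hsub : μ.restrict Z ≤ μ.restrict B := Measure.restrict_mono_set μ inter_subset_right
        have hv' := hv.mono_measure hsub
        have hw' := hw.mono_measure hsub
        refine setLIntegral_mono_ae (by fun_prop) (Eventually.of_forall fun z hz => ?_)
        have hz0 : w z = 0 := hz.1
        rw [hz0, sub_zero, ← ENNReal.ofReal_add (abs_nonneg _) (abs_nonneg _)]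
        refine ENNReal.ofReal_le_ofReal ?_
        rw [abs_sub_comm, add_comm]
        calc |m| = |v z + (m - v z)| := by rw [add_sub_cancel]
          _ ≤ _ := abs_add_le _ _
      _ ≤ ∫⁻ z in B, (ENNReal.ofReal |v z - m| + ENNReal.ofReal |v z - w z|) ∂μ :=
        lintegral_mono_set inter_subset_right
      _ = P + e := lintegral_add_left' hvm _
  calc ∫⁻ z in B, ENNReal.ofReal |w z| ∂μ
      ≤ ∫⁻ z in B, (ENNReal.ofReal |v z - m| + (ENNReal.ofReal |v z - w z| + ENNReal.ofReal |m|))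
          ∂μ := by
        refine lintegral_mono fun z => ?_
        rw [← ENNReal.ofReal_add (abs_nonneg _) (abs_nonneg _),
          ← ENNReal.ofReal_add (abs_nonneg _) (by positivity)]
        refine ENNReal.ofReal_le_ofReal ?_
        have e1 : w z = (v z - m) + (-(v z - w z) + m) := by ring
        calc |w z| ≤ |v z - m| + |-(v z - w z) + m| := by
              conv_lhs => rw [e1]
              exact abs_add_le _ _
          _ ≤ _ := by gcongr; exact (abs_add_le _ _).trans_eq (by rw [abs_neg])
    _ = P + (e + ENNReal.ofReal |m| * μ B) := by
        rw [lintegral_add_left' hvm, lintegral_add_right _ measurable_const, setLIntegral_const]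
    _ ≤ P + (e + 2 * (P + e)) := by
        refine add_le_add le_rfl (add_le_add le_rfl ?_)
        calc ENNReal.ofReal |m| * μ B ≤ ENNReal.ofReal |m| * (2 * μ Z) := by gcongr
          _ = 2 * (ENNReal.ofReal |m| * μ Z) := by ring
          _ ≤ 2 * (P + e) := by gcongr
    _ = 3 * (P + e) := by ring

lemma lintegral_biUnion_finset_le {ι : Type*} {μ : Measure X} (F : Finset ι) (A : ι → Set X)
    (f : X → ℝ≥0∞) : ∫⁻ z in ⋃ i ∈ F, A i, f z ∂μ ≤ ∑ i ∈ F, ∫⁻ z in A i, f z ∂μ := by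
  classical
  induction F using Finset.induction_on with
  | empty => simp
  | insert i F hi ih =>
    rw [Finset.set_biUnion_insert, Finset.sum_insert hi]
    exact (lintegral_union_le _ _ _).trans (add_le_add le_rfl ih)

section PoincareSobolev

variable [BorelSpace X] {μ : Measure X} {Cd CP lam : ℝ}

/-- The Poincaré inequality for locally Lipschitz functions defined near a ball. -/
lemma MMS.poincare_local (hX : MMS μ Cd CP lam) {W : Set X} {v : X → ℝ}
    {g : X → ℝ≥0∞} (hv : LocLipschitzOn v W) (hgm : Measurable g) (hg : IsUpperGradientOn g v W)
    {y : X} {r ρ : ℝ} (hr : 0 < r) (hρ : lam * r < ρ) (hW : closedBall y ρ ⊆ W) :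
    ∫⁻ z in ball y r, ENNReal.ofReal |v z - ⨍ z in ball y r, v z ∂μ| ∂μ ≤
      ENNReal.ofReal (CP * r) * ∫⁻ z in ball y (lam * r), g z ∂μ := by
  have := hX.properSpace
  have := hX.isLocallyFiniteMeasure
  set η := cutoff y (lam * r) ρ with hη
  set w : X → ℝ := fun z => η z * v z with hw
  obtain ⟨L, hL⟩ := hv _ (isCompact_closedBall y ρ) hW
  obtain ⟨C, hC⟩ := lipschitzWith_mul_of_eq_zero_off (isCompact_closedBall y ρ) hL
    (lipschitzWith_cutoff hρ) (η := η)
    (fun z => by rw [abs_of_nonneg (cutoff_nonneg _ _ _ _)]; exact cutoff_le_one _ _ _ _)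
    (fun z hz => cutoff_eq_zero hρ (by simpa using (not_le.1 hz).le))
  have hwv : ∀ z ∈ ball y (lam * r), w z = v z := fun z hz => by
    simp only [hw, hη, cutoff_eq_one hρ (mem_ball.1 hz).le, one_mul]
  have hlr : r ≤ lam * r := by nlinarith [hX.hlam]
  classical
  set g' : X → ℝ≥0∞ := (ball y (lam * r)).piecewise g (fun _ => ⊤) with hg'
  have hg'm : Measurable g' := hgm.piecewise measurableSet_ball measurable_const
  have hgg' : ∀ z, g z ≤ g' z := fun z => by
    by_cases hz : z ∈ ball y (lam * r)
    · rw [hg', piecewise_eq_of_mem _ _ _ hz]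
    · rw [hg', piecewise_eq_of_notMem _ _ _ hz]; exact le_top
  have hug : IsUpperGradientOn g' w univ := by
    intro γ _
    by_cases htop : curveIntegral g' γ = ⊤
    · rw [htop]; exact le_top
    have hfin : curveIntegral g γ ≠ ⊤ := by
      refine ne_top_of_le_ne_top htop (lintegral_mono fun t => ?_)
      dsimp only
      gcongr
      exact hgg' _
    obtain ⟨K, hK⟩ := γ.lipschitz
    have hsub : ball y (lam * r) ⊆ W := (ball_subset_closedBall.trans
      (closedBall_subset_closedBall hρ.le)).trans hW
    refine ofReal_abs_sub_le_curveIntegral ((hC.lipschitzOnWith (s := univ)).comp hK (mapsTo_univ _ _)) ?_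
    have hne1 : ∀ᵐ t : ℝ ∂(volume.restrict (Icc (0 : ℝ) 1)), t ≠ 1 :=
      ae_restrict_of_ae (by simp [ae_iff, measure_singleton])
    have hne0 : ∀ᵐ t : ℝ ∂(volume.restrict (Icc (0 : ℝ) 1)), t ≠ 0 :=
      ae_restrict_of_ae (by simp [ae_iff, measure_singleton])
    filter_upwards [(hg.mono hsub).ae_deriv_le isOpen_ball γ hfin, hne0, hne1,
      ae_restrict_mem measurableSet_Icc] with t ht ht0 ht1 htI
    by_cases htb : γ.toFun t ∈ ball y (lam * r)
    · have hcont : ContinuousAt γ.toFun t := γ.continuousOn.continuousAt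
        (Icc_mem_nhds (lt_of_le_of_ne htI.1 (Ne.symm ht0)) (lt_of_le_of_ne htI.2 ht1))
      have heq : w ∘ γ.toFun =ᶠ[𝓝 t] v ∘ γ.toFun := by
        filter_upwards [hcont (isOpen_ball.mem_nhds htb)] with τ hτ using hwv _ hτ
      rw [heq.deriv_eq, hg', piecewise_eq_of_mem _ _ _ htb]
      exact ht htb
    · rw [hg', piecewise_eq_of_notMem _ _ _ htb]
      refine (ofReal_abs_deriv_comp_le hC γ.toFun t).trans ?_
      gcongr
      exact le_top
  have hwint : LocallyIntegrable w μ := hC.continuous.locallyIntegrable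
  have hP := hX.poincare y r hr w hwint g' hg'm hug
  have h1 : ∫⁻ z in ball y (lam * r), g' z ∂μ = ∫⁻ z in ball y (lam * r), g z ∂μ :=
    setLIntegral_congr_fun measurableSet_ball fun z hz => by
      rw [hg', piecewise_eq_of_mem _ _ _ hz]
  have h2 : ⨍ z in ball y r, w z ∂μ = ⨍ z in ball y r, v z ∂μ := by
    rw [setAverage_eq, setAverage_eq]
    congr 1
    exact setIntegral_congr_fun measurableSet_ball fun z hz => hwv z (ball_subset_ball hlr hz)
  have h3 : ∫⁻ z in ball y r, ENNReal.ofReal |w z - ⨍ z in ball y r, w z ∂μ| ∂μ =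
      ∫⁻ z in ball y r, ENNReal.ofReal |v z - ⨍ z in ball y r, v z ∂μ| ∂μ :=
    setLIntegral_congr_fun measurableSet_ball fun z hz => by
      rw [h2, hwv z (ball_subset_ball hlr hz)]
  rw [h1, h3] at hP
  refine hP.trans ?_
  gcongr
  refine (mul_le_mul_right (ENNReal.div_le_of_le_mul ?_) _).trans_eq (mul_one _)
  rw [one_mul]
  exact measure_mono (ball_subset_ball hlr)

/-- A Sobolev-type inequality with a gain for functions of small support: if `w` vanishes on at
least half of every ball of radius `r`, then the mass of `w` is controlled by `r` times its total
variation. -/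
lemma MMS.lintegral_abs_le_tv (hX : MMS μ Cd CP lam) {w : X → ℝ} {x : X} {s S r : ℝ} (hr : 0 < r)
    (hS : s + lam * r < S) (hw : AEMeasurable w (μ.restrict (ball x S))) {n : ℕ} (hn : lam ≤ 2 ^ n)
    (hdens : ∀ y ∈ closedBall x s, 2 * μ ({z | w z ≠ 0} ∩ ball y r) ≤ μ (ball y r)) :
    ∫⁻ z in closedBall x s, ENNReal.ofReal |w z| ∂μ ≤
      3 * ENNReal.ofReal (CP * r) * ENNReal.ofReal Cd ^ (n + 3) * tv μ w (ball x S) := by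
  have := hX.properSpace
  have hlr : r ≤ lam * r := by nlinarith [hX.hlam]
  set D := ENNReal.ofReal Cd with hD
  have hD0 : D ≠ 0 := by simpa [hD] using lt_of_lt_of_le one_pos hX.hCd
  have hDtop : D ≠ ⊤ := ENNReal.ofReal_ne_top
  set C := 3 * ENNReal.ofReal (CP * r) * D ^ (n + 3) with hCdef
  have hCP0 : ENNReal.ofReal (CP * r) ≠ 0 := by simpa using mul_pos hX.hCP hr
  have hC0 : C ≠ 0 := mul_ne_zero (mul_ne_zero (by norm_num) hCP0) (pow_ne_zero _ hD0)
  have hCtop : C ≠ ⊤ := ENNReal.mul_ne_top (ENNReal.mul_ne_top (by norm_num) ENNReal.ofReal_ne_top)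
    (ENNReal.pow_ne_top hDtop)
  rw [mul_comm, ← ENNReal.div_le_iff hC0 hCtop]
  refine le_of_forall_gt_imp_ge_of_dense fun c hc => ?_
  suffices hle : ∫⁻ z in closedBall x s, ENNReal.ofReal |w z| ∂μ ≤ C * c from
      ENNReal.div_le_of_le_mul' hle
  obtain ⟨v, g, hv, hconv, hgm, hg, hgc, -⟩ := exists_seq_of_tv_lt isOpen_ball hc
  obtain ⟨F, hFA, hFcov, hFover⟩ := hX.exists_cover (A := closedBall x s) (x := x) (R := s + 1) hr
    (closedBall_subset_ball (by linarith))
  obtain ⟨ρ, hρ1, hρ2⟩ := exists_between (show lam * r < S - s by linarith)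
  set K := closedBall x (s + r) with hK
  have hKS : K ⊆ ball x S := closedBall_subset_ball (by linarith)
  have hKcomp : IsCompact K := isCompact_closedBall _ _
  set e : ℕ → ℝ≥0∞ := fun i => ∫⁻ z in K, ENNReal.ofReal |v i z - w z| ∂μ with he
  have hlim : Tendsto (fun i => C * c + 3 * F.card * e i) atTop (𝓝 (C * c + 3 * F.card * 0)) := by
    refine tendsto_const_nhds.add (ENNReal.Tendsto.const_mul (hconv K hKcomp hKS) (Or.inr ?_))
    exact ENNReal.mul_ne_top (by norm_num) (ENNReal.natCast_ne_top _)
  rw [mul_zero, add_zero] at hlim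
  refine ge_of_tendsto' hlim fun i => ?_
  have hball : ∀ y ∈ F, ∫⁻ z in ball y r, ENNReal.ofReal |w z| ∂μ ≤
      3 * (ENNReal.ofReal (CP * r) * ∫⁻ z in ball y (lam * r), g i z ∂μ + e i) := by
    intro y hy
    have hyx : dist y x ≤ s := hFA y hy
    have hyK : ball y r ⊆ K := fun z hz => by
      rw [hK, mem_closedBall]
      linarith [dist_triangle z y x, mem_ball.1 hz]
    have hvm : AEMeasurable (v i) (μ.restrict (ball y r)) :=
      (((hv i).continuousOn_of_isCompact hKcomp hKS).mono hyK).aemeasurable measurableSet_ball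
    refine (lintegral_abs_le_of_vanishing (hX.measure_ball_lt_top y r).ne hvm
      (hw.mono_measure (Measure.restrict_mono_set μ (hyK.trans hKS)))
      (hdens y (hFA y hy)) (⨍ z in ball y r, v i z ∂μ)).trans ?_
    gcongr
    · refine hX.poincare_local (hv i) (hgm i) (hg i) hr hρ1 fun z hz => ?_
      rw [mem_ball]
      linarith [dist_triangle z y x, mem_closedBall.1 hz]
    · exact lintegral_mono_set hyK
  have hover : ∑ y ∈ F, ∫⁻ z in ball y (lam * r), g i z ∂μ ≤ D ^ (n + 3) * c := by
    calc ∑ y ∈ F, ∫⁻ z in ball y (lam * r), g i z ∂μ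
        = ∑ y ∈ F, ∫⁻ z in ball x S, (ball y (lam * r)).indicator (g i) z ∂μ := by
          refine Finset.sum_congr rfl fun y hy => ?_
          rw [lintegral_indicator measurableSet_ball, Measure.restrict_restrict measurableSet_ball,
            inter_eq_self_of_subset_left]
          intro z hz
          rw [mem_ball]
          have hyx : dist y x ≤ s := hFA y hy
          linarith [dist_triangle z y x, mem_ball.1 hz]
      _ = ∫⁻ z in ball x S, ∑ y ∈ F, (ball y (lam * r)).indicator (g i) z ∂μ :=
          (lintegral_finsetSum _ fun y _ => (hgm i).indicator measurableSet_ball).symm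
      _ ≤ ∫⁻ z in ball x S, D ^ (n + 3) * g i z ∂μ := by
          refine lintegral_mono fun z => ?_
          classical
          simp only [indicator_apply]
          rw [← Finset.sum_filter, Finset.sum_const, nsmul_eq_mul]
          gcongr
          refine hFover n z _ (Finset.filter_subset _ _) fun y hy => ?_
          refine ball_subset_ball ?_ (Finset.mem_filter.1 hy).2
          gcongr
      _ = D ^ (n + 3) * ∫⁻ z in ball x S, g i z ∂μ := lintegral_const_mul _ (hgm i)
      _ ≤ _ := by gcongr; exact (hgc i).le
  calc ∫⁻ z in closedBall x s, ENNReal.ofReal |w z| ∂μ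
      ≤ ∫⁻ z in ⋃ y ∈ F, ball y r, ENNReal.ofReal |w z| ∂μ := lintegral_mono_set hFcov
    _ ≤ ∑ y ∈ F, ∫⁻ z in ball y r, ENNReal.ofReal |w z| ∂μ := by
        exact lintegral_biUnion_finset_le F _ _
    _ ≤ ∑ y ∈ F, 3 * (ENNReal.ofReal (CP * r) * ∫⁻ z in ball y (lam * r), g i z ∂μ + e i) :=
        Finset.sum_le_sum hball
    _ = 3 * (ENNReal.ofReal (CP * r) * ∑ y ∈ F, ∫⁻ z in ball y (lam * r), g i z ∂μ) +
        3 * F.card * e i := by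
        rw [← Finset.mul_sum, Finset.sum_add_distrib, ← Finset.mul_sum, Finset.sum_const,
          nsmul_eq_mul]
        ring
    _ ≤ 3 * (ENNReal.ofReal (CP * r) * (D ^ (n + 3) * c)) + 3 * F.card * e i := by gcongr
    _ = C * c + 3 * F.card * e i := by rw [hCdef]; ring

end PoincareSobolev

lemma add_le_of_le_liminf {a b c : ℕ → ℝ≥0∞} {A B C : ℝ≥0∞} (ha : A ≤ liminf a atTop)
    (hb : B ≤ liminf b atTop) (habc : ∀ i, a i + b i ≤ c i) (hc : Tendsto c atTop (𝓝 C)) :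
    A + B ≤ C := by
  refine (add_le_add ha hb).trans ?_
  rw [liminf_eq_iSup_iInf_of_nat, liminf_eq_iSup_iInf_of_nat, ENNReal.iSup_add_iSup_of_monotone]
  · refine iSup_le fun n => ge_of_tendsto hc ?_
    filter_upwards [eventually_ge_atTop n] with i hi
    exact (add_le_add (iInf₂_le i hi) (iInf₂_le i hi)).trans (habc i)
  · exact fun m n hmn => le_iInf₂ fun i hi => iInf₂_le i (hmn.trans hi)
  · exact fun m n hmn => le_iInf₂ fun i hi => iInf₂_le i (hmn.trans hi)

lemma deriv_max_sub_zero {f : ℝ → ℝ} {t k : ℝ} (hf : ContinuousAt f t) :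
    deriv (fun τ => max (f τ - k) 0) t = if k < f t then deriv f t else 0 := by
  split_ifs with h
  · have : (fun τ => max (f τ - k) 0) =ᶠ[𝓝 t] fun τ => f τ - k := by
      filter_upwards [hf (Ioi_mem_nhds h)] with τ hτ
      exact max_eq_left (sub_nonneg.2 (le_of_lt hτ))
    rw [this.deriv_eq, deriv_sub_const]
  · refine IsLocalMin.deriv_eq_zero (Eventually.of_forall fun τ => ?_)
    dsimp only
    rw [max_eq_right (by linarith)]
    exact le_max_right _ _

lemma deriv_mul_neg_max {f e : ℝ → ℝ} {t k δ : ℝ} (he0 : 0 < e t)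
    (he : DifferentiableAt ℝ e t) (hf : ContinuousAt f t)
    (hd : DifferentiableAt ℝ (fun τ => e τ * -(max (f τ - k) 0 + δ)) t) :
    deriv (fun τ => e τ * -(max (f τ - k) 0 + δ)) t =
      -(deriv e t * (max (f t - k) 0 + δ)) - e t * (if k < f t then deriv f t else 0) := by
  have heq : (fun τ => max (f τ - k) 0) =ᶠ[𝓝 t]
      fun τ => -((e τ * -(max (f τ - k) 0 + δ)) / e τ) - δ := by
    filter_upwards [he.continuousAt (Ioi_mem_nhds he0)] with τ hτ
    have : e τ ≠ 0 := (show 0 < e τ from hτ).ne'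
    field_simp
    ring
  have hR : DifferentiableAt ℝ (fun τ => max (f τ - k) 0) t :=
    ((hd.div he he0.ne').neg.sub_const δ).congr_of_eventuallyEq heq
  have h1 := (he.hasDerivAt.mul (hR.hasDerivAt.add_const δ).neg).deriv
  rw [deriv_max_sub_zero hf] at h1
  have h2 : (fun τ => e τ * -(max (f τ - k) 0 + δ)) =
      e * -(fun τ => max (f τ - k) 0 + δ) := rfl
  rw [h2, h1]
  simp only [Pi.neg_apply]
  ring

lemma deriv_mul_neg_max_of_eq_zero {f e : ℝ → ℝ} {t k δ : ℝ} (hδ : 0 ≤ δ) (he0 : ∀ τ, 0 ≤ e τ)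
    (het : e t = 0) : deriv (fun τ => e τ * -(max (f τ - k) 0 + δ)) t = 0 := by
  refine IsLocalMax.deriv_eq_zero (Eventually.of_forall fun τ => ?_)
  dsimp only
  rw [het, zero_mul]
  have := le_max_right (f τ - k) 0
  exact mul_nonpos_of_nonneg_of_nonpos (he0 τ) (by linarith)

lemma Curve.ae_continuousAt (γ : Curve X) :
    ∀ᵐ t ∂(volume.restrict (Icc (0 : ℝ) 1)), ContinuousAt γ.toFun t := by
  have hne1 : ∀ᵐ t : ℝ ∂(volume.restrict (Icc (0 : ℝ) 1)), t ≠ 1 :=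
    ae_restrict_of_ae (by simp [ae_iff, measure_singleton])
  have hne0 : ∀ᵐ t : ℝ ∂(volume.restrict (Icc (0 : ℝ) 1)), t ≠ 0 :=
    ae_restrict_of_ae (by simp [ae_iff, measure_singleton])
  filter_upwards [hne0, hne1, ae_restrict_mem measurableSet_Icc] with t ht0 ht1 htI
  exact γ.continuousOn.continuousAt
    (Icc_mem_nhds (lt_of_le_of_ne htI.1 (Ne.symm ht0)) (lt_of_le_of_ne htI.2 ht1))

lemma LocLipschitzOn.continuousOn [ProperSpace X] {v : X → ℝ} {W : Set X}
    (hv : LocLipschitzOn v W) (hW : IsOpen W) : ContinuousOn v W := by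
  intro z hz
  obtain ⟨r, hr, hrW⟩ := Metric.nhds_basis_closedBall.mem_iff.1 (hW.mem_nhds hz)
  exact ((hv.continuousOn_of_isCompact (isCompact_closedBall z r) hrW).continuousAt
    (closedBall_mem_nhds z hr)).continuousWithinAt

lemma LocLipschitzOn.max_sub_zero {v : X → ℝ} {W : Set X} (hv : LocLipschitzOn v W) (k : ℝ) :
    LocLipschitzOn (fun z => max (v z - k) 0) W := by
  intro K hK hKW
  obtain ⟨L, hL⟩ := hv K hK hKW
  refine ⟨L, LipschitzOnWith.of_dist_le_mul fun z hz z' hz' => ?_⟩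
  refine le_trans ?_ (hL.dist_le_mul z hz z' hz')
  rw [Real.dist_eq, Real.dist_eq]
  refine (abs_max_sub_max_le_abs _ _ _).trans_eq ?_
  congr 1
  ring

section Truncation

variable [BorelSpace X] [ProperSpace X] (μ : Measure X) {W T : Set X} {v η : X → ℝ}
  {g : X → ℝ≥0∞} {L : ℝ≥0} {k δ : ℝ}

lemma isWeakUpperGradientOn_max_sub_zero (hW : IsOpen W) (hv : LocLipschitzOn v W)
    (hgm : Measurable g) (hg : IsUpperGradientOn g v W) (hfin : ∫⁻ z, g z ∂μ ≠ ⊤) :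
    IsWeakUpperGradientOn μ ((W ∩ {z | k < v z}).indicator g) (fun z => max (v z - k) 0) W := by
  refine isWeakUpperGradientOn_of_deriv μ hgm hfin (hv.max_sub_zero k) fun γ hγ hγfin => ?_
  filter_upwards [hg.ae_deriv_le hW γ hγfin, γ.ae_continuousAt, ae_restrict_mem measurableSet_Icc]
    with t ht hc htI
  have hvc : ContinuousAt (v ∘ γ.toFun) t := ContinuousAt.comp
    ((hv.continuousOn hW).continuousAt (hW.mem_nhds (hγ t htI))) hc
  have h := deriv_max_sub_zero (k := k) hvc
  have h' : (fun z => max (v z - k) 0) ∘ γ.toFun = fun τ => max ((v ∘ γ.toFun) τ - k) 0 := rfl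
  rw [h', h]
  split_ifs with hk
  · rw [indicator_of_mem (show γ.toFun t ∈ W ∩ {z | k < v z} from ⟨hγ t htI, hk⟩)]
    exact ht (hγ t htI)
  · simp

variable (hW : IsOpen W) (hv : LocLipschitzOn v W) (hgm : Measurable g)
  (hg : IsUpperGradientOn g v W) (hfin : ∫⁻ z, g z ∂μ ≠ ⊤) (hη : LipschitzWith L η)
  (hη0 : ∀ z, 0 ≤ η z) (hη1 : ∀ z, η z ≤ 1) (hT : IsCompact T) (hTW : T ⊆ W)
  (hηT : ∀ z ∉ T, η z = 0) (hδ : 0 ≤ δ)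

include hv hη hη0 hη1 hT hTW hηT in
lemma lipschitzWith_mul_neg_max :
    ∃ C : ℝ≥0, LipschitzWith C fun z => η z * -(max (v z - k) 0 + δ) := by
  obtain ⟨L', hL'⟩ := hv.max_sub_zero k T hT hTW
  refine lipschitzWith_mul_of_eq_zero_off hT (L := L') (LipschitzOnWith.of_dist_le_mul
    fun z hz z' hz' => ?_) hη (fun z => by rw [abs_of_nonneg (hη0 z)]; exact hη1 z) hηT
  rw [dist_neg_neg, dist_add_right]
  exact hL'.dist_le_mul z hz z' hz'

include hW hv hη hη0 hη1 hT hTW hηT hδ in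
lemma ae_deriv_mul_neg_max (γ : Curve X) :
    ∀ᵐ t ∂(volume.restrict (Icc (0 : ℝ) 1)),
      (η (γ.toFun t) = 0 ∧ deriv ((fun z => η z * -(max (v z - k) 0 + δ)) ∘ γ.toFun) t = 0) ∨
      (γ.toFun t ∈ T ∧ deriv ((fun z => η z * -(max (v z - k) 0 + δ)) ∘ γ.toFun) t =
        -(deriv (η ∘ γ.toFun) t * (max (v (γ.toFun t) - k) 0 + δ)) -
          η (γ.toFun t) * (if k < v (γ.toFun t) then deriv (v ∘ γ.toFun) t else 0)) := by
  obtain ⟨C, hC⟩ := lipschitzWith_mul_neg_max (k := k) (δ := δ) hv hη hη0 hη1 hT hTW hηT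
  obtain ⟨K, hK⟩ := γ.lipschitz
  filter_upwards [γ.ae_continuousAt,
    ae_differentiableAt_of_lipschitzOn_Icc
      ((hη.lipschitzOnWith (s := univ)).comp hK (mapsTo_univ _ _)),
    ae_differentiableAt_of_lipschitzOn_Icc
      ((hC.lipschitzOnWith (s := univ)).comp hK (mapsTo_univ _ _))] with t hc hde hdw
  rcases (hη0 (γ.toFun t)).eq_or_lt with h0 | h0
  · exact Or.inl ⟨h0.symm, deriv_mul_neg_max_of_eq_zero (f := v ∘ γ.toFun) (e := η ∘ γ.toFun) hδ
      (fun τ => hη0 _) h0.symm⟩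
  · have hmem : γ.toFun t ∈ T := by
      by_contra h
      exact h0.ne' (hηT _ h)
    have hvc : ContinuousAt (v ∘ γ.toFun) t := ContinuousAt.comp
      ((hv.continuousOn hW).continuousAt (hW.mem_nhds (hTW hmem))) hc
    exact Or.inr ⟨hmem, deriv_mul_neg_max (f := v ∘ γ.toFun) (e := η ∘ γ.toFun) h0 hde hvc hdw⟩

include hW hv hgm hg hfin hη hη0 hη1 hT hTW hηT hδ in
lemma isWeakUpperGradientOn_mul_neg_max (Ω : Set X) :
    IsWeakUpperGradientOn μ
      (fun z => g z + L * T.indicator (fun z => ENNReal.ofReal (max (v z - k) 0 + δ)) z)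
      (fun z => η z * -(max (v z - k) 0 + δ)) Ω := by
  obtain ⟨C, hC⟩ := lipschitzWith_mul_neg_max (k := k) (δ := δ) hv hη hη0 hη1 hT hTW hηT
  refine isWeakUpperGradientOn_of_deriv μ hgm hfin (fun K _ _ => ⟨C, hC.lipschitzOnWith⟩)
    fun γ _ hγfin => ?_
  filter_upwards [hg.ae_deriv_le hW γ hγfin,
    ae_deriv_mul_neg_max (k := k) hW hv hη hη0 hη1 hT hTW hηT hδ γ] with t ht h
  rcases h with ⟨-, h⟩ | ⟨hmem, h⟩
  · rw [h]; simp
  have hR0 : 0 ≤ max (v (γ.toFun t) - k) 0 + δ := add_nonneg (le_max_right _ _) hδ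
  have hD : |if k < v (γ.toFun t) then deriv (v ∘ γ.toFun) t else 0| ≤
      |deriv (v ∘ γ.toFun) t| := by split_ifs <;> simp
  rw [h, indicator_of_mem hmem]
  set D := if k < v (γ.toFun t) then deriv (v ∘ γ.toFun) t else 0
  set R := max (v (γ.toFun t) - k) 0 + δ
  calc ENNReal.ofReal |-(deriv (η ∘ γ.toFun) t * R) - η (γ.toFun t) * D|
      ≤ ENNReal.ofReal (|deriv (v ∘ γ.toFun) t| + |deriv (η ∘ γ.toFun) t| * R) := by
        refine ENNReal.ofReal_le_ofReal ((abs_sub _ _).trans ?_)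
        rw [abs_neg, abs_mul, abs_mul, abs_of_nonneg hR0, abs_of_nonneg (hη0 _), add_comm]
        refine add_le_add ?_ le_rfl
        calc η (γ.toFun t) * |D| ≤ 1 * |D| := by gcongr; exact hη1 _
          _ ≤ _ := by rwa [one_mul]
    _ = ENNReal.ofReal |deriv (v ∘ γ.toFun) t| +
        ENNReal.ofReal |deriv (η ∘ γ.toFun) t| * ENNReal.ofReal R := by
        rw [ENNReal.ofReal_add (abs_nonneg _) (by positivity), ENNReal.ofReal_mul (abs_nonneg _)]
    _ ≤ g (γ.toFun t) * speed γ.toFun t + (L * speed γ.toFun t) * ENNReal.ofReal R := by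
        gcongr
        exacts [ht (hTW hmem), ofReal_abs_deriv_comp_le hη _ _]
    _ = _ := by ring

include hW hv hgm hg hfin hη hη0 hη1 hT hTW hηT hδ in
lemma isWeakUpperGradientOn_add_mul_neg_max :
    IsWeakUpperGradientOn μ
      (fun z => g z * ENNReal.ofReal (1 - (W ∩ {z | k < v z}).indicator η z) +
        L * T.indicator (fun z => ENNReal.ofReal (max (v z - k) 0 + δ)) z)
      (fun z => v z + η z * -(max (v z - k) 0 + δ)) W := by
  obtain ⟨C, hC⟩ := lipschitzWith_mul_neg_max (k := k) (δ := δ) hv hη hη0 hη1 hT hTW hηT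
  refine isWeakUpperGradientOn_of_deriv μ hgm hfin (fun K hK hKW => ?_) fun γ hγ hγfin => ?_
  · obtain ⟨L', hL'⟩ := hv K hK hKW
    exact ⟨L' + C, hL'.add hC.lipschitzOnWith⟩
  obtain ⟨K, hK⟩ := γ.lipschitz
  obtain ⟨K', hK'⟩ := hv.comp_curve hγ
  filter_upwards [hg.ae_deriv_le hW γ hγfin,
    ae_deriv_mul_neg_max (k := k) hW hv hη hη0 hη1 hT hTW hηT hδ γ,
    ae_differentiableAt_of_lipschitzOn_Icc hK', ae_differentiableAt_of_lipschitzOn_Icc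
      ((hC.lipschitzOnWith (s := univ)).comp hK (mapsTo_univ _ _)),
    ae_restrict_mem measurableSet_Icc] with t ht h hdv hdw htI
  have ht := ht (hγ t htI)
  have hsum : deriv ((fun z => v z + η z * -(max (v z - k) 0 + δ)) ∘ γ.toFun) t =
      deriv (v ∘ γ.toFun) t + deriv ((fun z => η z * -(max (v z - k) 0 + δ)) ∘ γ.toFun) t :=
    (hdv.hasDerivAt.add hdw.hasDerivAt).deriv
  rw [hsum]
  rcases h with ⟨h0, h⟩ | ⟨hmem, h⟩
  · have hi : (W ∩ {z | k < v z}).indicator η (γ.toFun t) = 0 := by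
      by_cases hk : γ.toFun t ∈ W ∩ {z | k < v z}
      · rw [indicator_of_mem hk, h0]
      · rw [indicator_of_notMem hk]
    rw [h, hi, add_zero, sub_zero, ENNReal.ofReal_one, mul_one, add_mul]
    exact ht.trans le_self_add
  have hR0 : 0 ≤ max (v (γ.toFun t) - k) 0 + δ := add_nonneg (le_max_right _ _) hδ
  have hD : deriv (v ∘ γ.toFun) t -
      η (γ.toFun t) * (if k < v (γ.toFun t) then deriv (v ∘ γ.toFun) t else 0) =
      deriv (v ∘ γ.toFun) t * (1 - (W ∩ {z | k < v z}).indicator η (γ.toFun t)) := by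
    split_ifs with hk
    · rw [indicator_of_mem (show γ.toFun t ∈ W ∩ {z | k < v z} from ⟨hγ t htI, hk⟩)]
      ring
    · rw [indicator_of_notMem (fun hh => hk hh.2)]
      ring
  have hi1 : 0 ≤ 1 - (W ∩ {z | k < v z}).indicator η (γ.toFun t) := by
    by_cases hk : γ.toFun t ∈ W ∩ {z | k < v z}
    · rw [indicator_of_mem hk]; linarith [hη1 (γ.toFun t)]
    · rw [indicator_of_notMem hk]; norm_num
  rw [h, indicator_of_mem hmem]
  set I := (W ∩ {z | k < v z}).indicator η (γ.toFun t)
  set R := max (v (γ.toFun t) - k) 0 + δ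
  set D := if k < v (γ.toFun t) then deriv (v ∘ γ.toFun) t else 0
  calc ENNReal.ofReal |deriv (v ∘ γ.toFun) t +
        (-(deriv (η ∘ γ.toFun) t * R) - η (γ.toFun t) * D)|
      ≤ ENNReal.ofReal (|deriv (v ∘ γ.toFun) t| * (1 - I) + |deriv (η ∘ γ.toFun) t| * R) := by
        refine ENNReal.ofReal_le_ofReal ?_
        have e1 : deriv (v ∘ γ.toFun) t + (-(deriv (η ∘ γ.toFun) t * R) - η (γ.toFun t) * D) =
            deriv (v ∘ γ.toFun) t * (1 - I) - deriv (η ∘ γ.toFun) t * R := by rw [← hD]; ring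
        rw [e1]
        refine (abs_sub _ _).trans_eq ?_
        rw [abs_mul, abs_mul, abs_of_nonneg hR0, abs_of_nonneg hi1]
    _ = ENNReal.ofReal |deriv (v ∘ γ.toFun) t| * ENNReal.ofReal (1 - I) +
        ENNReal.ofReal |deriv (η ∘ γ.toFun) t| * ENNReal.ofReal R := by
        rw [ENNReal.ofReal_add (by positivity) (by positivity), ENNReal.ofReal_mul (abs_nonneg _),
          ENNReal.ofReal_mul (abs_nonneg _)]
    _ ≤ (g (γ.toFun t) * speed γ.toFun t) * ENNReal.ofReal (1 - I) +
        (L * speed γ.toFun t) * ENNReal.ofReal R := by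
        gcongr
        exact ofReal_abs_deriv_comp_le hη _ _
    _ = _ := by ring

end Truncation

section Caccioppoli

variable [BorelSpace X] {μ : Measure X} {Cd CP lam : ℝ} {Ω : Set X} {u : X → ℝ}

lemma abs_max_sub_max_le (a b k : ℝ) : |max (a - k) 0 - max (b - k) 0| ≤ |a - b| :=
  (abs_max_sub_max_le_abs _ _ _).trans_eq (by congr 1; ring)

lemma caccioppoli_aux (hX : MMS μ Cd CP lam) (hu : IsMinimizer μ u Ω) {x : X} {s S k δ : ℝ}
    (hs : s < S) (hΩ : closedBall x S ⊆ Ω) (hδ : 0 < δ) :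
    tv μ (fun y => max (u y - k) 0) (ball x s) ≤ ENNReal.ofReal (1 / (S - s)) *
      ∫⁻ y in closedBall x S, ENNReal.ofReal (max (u y - k) 0 + δ) ∂μ := by
  have := hX.properSpace
  have := hX.isLocallyFiniteMeasure
  set η := cutoff x s S with hη
  have hη0 : ∀ z, 0 ≤ η z := cutoff_nonneg x s S
  have hη1 : ∀ z, η z ≤ 1 := cutoff_le_one x s S
  have hηa : ∀ z, |η z| ≤ 1 := fun z => by rw [abs_of_nonneg (hη0 z)]; exact hη1 z
  set L := Real.toNNReal (1 / (S - s)) with hL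
  have hηL : LipschitzWith L η := lipschitzWith_cutoff hs
  set φ : X → ℝ := fun z => η z * -(max (u z - k) 0 + δ) with hφ
  set T := tsupport φ with hTdef
  have hsupp : ∀ z, φ z ≠ 0 ↔ z ∈ ball x S := by
    intro z
    have h1 : -(max (u z - k) 0 + δ) ≠ 0 := by
      have := le_max_right (u z - k) 0
      exact neg_ne_zero.2 (by linarith)
    rw [hφ, mul_ne_zero_iff_right h1]
    constructor
    · intro h
      by_contra hz
      exact h (cutoff_eq_zero hs (not_lt.1 hz))
    · intro hz
      exact (cutoff_pos hs hz).ne'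
  have hsupp' : Function.support φ = ball x S := Set.ext hsupp
  have hTS : T ⊆ closedBall x S := by
    rw [hTdef, tsupport, hsupp']
    exact closure_ball_subset_closedBall
  have hbT : ball x S ⊆ T := by
    rw [hTdef, tsupport, hsupp']; exact subset_closure
  have hsT : ball x s ⊆ T := (ball_subset_ball hs.le).trans hbT
  have hT : IsCompact T := (isCompact_closedBall x S).of_isClosed_subset (isClosed_tsupport _) hTS
  have hηT : ∀ z ∉ T, η z = 0 := fun z hz =>
    cutoff_eq_zero hs (not_lt.1 fun h => hz (hbT h))
  obtain ⟨U, hU, hTU, hUΩ, huU, htvU⟩ := hu.1 T hT (hTS.trans hΩ)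
  set q := ∫⁻ y in T, ENNReal.ofReal (max (u y - k) 0 + δ) ∂μ with hq
  have huT : IntegrableOn u T μ := huU.mono_set hTU
  have hμT : μ T ≠ ⊤ := hT.measure_lt_top.ne
  have hRint : IntegrableOn (fun y => max (u y - k) 0 + δ) T μ := by
    have hc : ∀ c : ℝ, IntegrableOn (fun _ : X => c) T μ := fun c => integrableOn_const hμT
    exact ((huT.sub (hc k)).pos_part).add (hc δ)
  have hqfin : q ≠ ⊤ := by
    refine ne_top_of_le_ne_top hRint.hasFiniteIntegral.ne (lintegral_mono fun y => ?_)
    exact Real.ofReal_le_enorm _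
  -- estimates common to all approximating sequences
  have hqi : ∀ v : X → ℝ, ∫⁻ y in T, ENNReal.ofReal (max (v y - k) 0 + δ) ∂μ ≤
      q + ∫⁻ y in T, ENNReal.ofReal |v y - u y| ∂μ := by
    intro v
    rw [hq, ← lintegral_add_left' (hRint.aemeasurable.ennreal_ofReal)]
    refine lintegral_mono fun y => ?_
    rw [← ENNReal.ofReal_add (add_nonneg (le_max_right _ _) hδ.le) (abs_nonneg _)]
    refine ENNReal.ofReal_le_ofReal ?_
    have := (le_abs_self _).trans (abs_max_sub_max_le (v y) (u y) k)
    linarith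
  have hmd : ∀ (v : X → ℝ) z, |η z * -(max (v z - k) 0 + δ) - φ z| ≤ |v z - u z| := by
    intro v z
    have e : η z * -(max (v z - k) 0 + δ) - φ z =
        η z * (max (u z - k) 0 - max (v z - k) 0) := by rw [hφ]; ring
    rw [e, abs_mul]
    calc |η z| * |max (u z - k) 0 - max (v z - k) 0| ≤ 1 * |u z - v z| :=
          mul_le_mul (hηa z) (abs_max_sub_max_le _ _ _) (abs_nonneg _) zero_le_one
      _ = _ := by rw [one_mul, abs_sub_comm]
  have hRm : ∀ (v : X → ℝ) {W : Set X}, LocLipschitzOn v W → T ⊆ W →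
      Measurable (T.indicator fun z => ENNReal.ofReal (max (v z - k) 0 + δ)) := by
    intro v W hv hTW
    classical
    rw [← piecewise_eq_indicator]
    refine ContinuousOn.measurable_piecewise ?_ continuousOn_const hT.measurableSet
    have hvc := hv.continuousOn_of_isCompact hT hTW
    exact ENNReal.continuous_ofReal.comp_continuousOn
      (((hvc.sub continuousOn_const).sup continuousOn_const).add continuousOn_const)
  have hTind : ∀ (v : X → ℝ) (A : Set X),
      ∫⁻ z in A, T.indicator (fun z => ENNReal.ofReal (max (v z - k) 0 + δ)) z ∂μ ≤
        ∫⁻ y in T, ENNReal.ofReal (max (v y - k) 0 + δ) ∂μ := by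
    intro v A
    refine (setLIntegral_le_lintegral A _).trans_eq ?_
    rw [lintegral_indicator hT.measurableSet]
  -- the test function is admissible
  have hφint : IntegrableOn φ Ω μ := by
    have h1 : Integrable φ μ := by
      have h2 : IntegrableOn φ T μ := by
        refine Integrable.mono hRint ?_ (Eventually.of_forall fun z => ?_)
        · exact (hηL.continuous.aestronglyMeasurable).mul hRint.aestronglyMeasurable.neg
        · rw [hφ, norm_mul, norm_neg]
          exact mul_le_of_le_one_left (norm_nonneg _) (hηa z)
      exact (integrableOn_iff_integrable_of_support_subset (subset_tsupport φ)).1 h2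
    exact h1.integrableOn
  have hφtv : tv μ φ Ω < ⊤ := by
    obtain ⟨c, hc, hctop⟩ := exists_between htvU
    obtain ⟨v, g, hv, hconv, hgm, hg, hgc, hgeq⟩ := exists_seq_of_tv_lt hU hc
    have hfin : ∀ i, ∫⁻ z, g i z ∂μ ≠ ⊤ := fun i => by
      rw [hgeq]; exact ((hgc i).trans hctop).ne
    have hb : tv μ φ Ω ≤ c + L * (q + 1) := by
      refine (tv_le_liminf (v := fun i z => η z * -(max (v i z - k) 0 + δ))
        (g := fun i z => g i z +
          L * T.indicator (fun z => ENNReal.ofReal (max (v i z - k) 0 + δ)) z)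
        (fun i K _ _ => ?_) (fun K hK _ => ?_) (fun i => ?_) fun i => ?_).trans ?_
      · obtain ⟨C, hC⟩ := lipschitzWith_mul_neg_max (k := k) (δ := δ) (hv i) hηL hη0 hη1 hT hTU hηT
        exact ⟨C, hC.lipschitzOnWith⟩
      · refine tendsto_of_tendsto_of_tendsto_of_le_of_le tendsto_const_nhds (hconv T hT hTU)
          (fun _ => zero_le) fun i => ?_
        dsimp only
        rw [← lintegral_indicator hT.measurableSet]
        refine (setLIntegral_le_lintegral K _).trans (lintegral_mono fun z => ?_)
        by_cases hz : z ∈ T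
        · rw [indicator_of_mem hz]
          exact ENNReal.ofReal_le_ofReal (hmd (v i) z)
        · rw [indicator_of_notMem hz, hφ]
          simp [hηT z hz]
      · exact (hgm i).add ((hRm (v i) (hv i) hTU).const_mul _)
      · exact isWeakUpperGradientOn_mul_neg_max μ hU (hv i) (hgm i) (hg i) (hfin i) hηL hη0 hη1
          hT hTU hηT hδ.le Ω
      · refine liminf_le_of_frequently_le' (Eventually.frequently ?_)
        filter_upwards [(hconv T hT hTU).eventually (Iio_mem_nhds one_pos)] with i hi
        rw [lintegral_add_left (hgm i), lintegral_const_mul _ (hRm (v i) (hv i) hTU)]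
        gcongr
        · calc ∫⁻ z in Ω, g i z ∂μ ≤ ∫⁻ z, g i z ∂μ := setLIntegral_le_lintegral _ _
            _ ≤ c := by rw [hgeq]; exact (hgc i).le
        · refine ((hTind _ _).trans (hqi (v i))).trans ?_
          exact add_le_add le_rfl (mem_Iio.1 hi).le
    refine hb.trans_lt (ENNReal.add_lt_top.2 ⟨hctop, ENNReal.mul_lt_top ENNReal.coe_lt_top ?_⟩)
    exact ENNReal.add_lt_top.2 ⟨hqfin.lt_top, ENNReal.one_lt_top⟩
  have hmin := hu.2 φ ⟨⟨hφint, hφtv⟩, hT, hTS.trans hΩ⟩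
  set A := tvs μ u T with hA
  have hAfin : A ≠ ⊤ := ne_top_of_le_ne_top htvU.ne (iInf_le_of_le U (iInf₂_le hU hTU))
  suffices hmain : ∀ c, A < c → A + tv μ (fun y => max (u y - k) 0) (ball x s) ≤ c + L * q by
    have h1 : A + tv μ (fun y => max (u y - k) 0) (ball x s) ≤ A + L * q := by
      have hcont : Tendsto (fun c : ℝ≥0∞ => c + L * q) (𝓝[>] A) (𝓝 (A + L * q)) :=
        ((continuous_id.add continuous_const).tendsto A).mono_left nhdsWithin_le_nhds
      have : (𝓝[>] A).NeBot := nhdsGT_neBot_of_exists_gt ⟨⊤, hAfin.lt_top⟩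
      exact ge_of_tendsto hcont (by filter_upwards [self_mem_nhdsWithin] with c hc using hmain c hc)
    refine ((ENNReal.add_le_add_iff_left hAfin).1 h1).trans ?_
    have hLe : (L : ℝ≥0∞) = ENNReal.ofReal (1 / (S - s)) := rfl
    rw [hLe]
    gcongr
    exact lintegral_mono_set hTS
  intro c hc
  have hc' := hc
  rw [hA] at hc'
  unfold tvs at hc'
  simp only [iInf_lt_iff] at hc'
  obtain ⟨V, hV, hTV, hVc⟩ := hc'
  set W := V ∩ U with hWdef
  have hW : IsOpen W := hV.inter hU
  have hTW : T ⊆ W := subset_inter hTV hTU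
  by_cases hctop : c = ⊤
  · rw [hctop, top_add]; exact le_top
  obtain ⟨v, g, hv, hconv, hgm, hg, hgc, hgeq⟩ :=
    exists_seq_of_tv_lt hW ((tv_mono inter_subset_left).trans_lt hVc)
  have hfin : ∀ i, ∫⁻ z, g i z ∂μ ≠ ⊤ := fun i => by
    rw [hgeq]; exact ((hgc i).trans_le le_top).ne
  have hEo : ∀ i, IsOpen (W ∩ {z | k < v i z}) := fun i =>
    ((hv i).continuousOn hW).isOpen_inter_preimage hW isOpen_Ioi
  have hEη : ∀ i, Measurable ((W ∩ {z | k < v i z}).indicator η) := fun i =>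
    hηL.continuous.measurable.indicator (hEo i).measurableSet
  have hh1 : A ≤ liminf (fun i => ∫⁻ z in W, (g i z *
      ENNReal.ofReal (1 - (W ∩ {z | k < v i z}).indicator η z) +
        L * T.indicator (fun z => ENNReal.ofReal (max (v i z - k) 0 + δ)) z) ∂μ) atTop := by
    refine hmin.trans ((iInf_le_of_le W (iInf₂_le hW hTW)).trans ?_)
    refine tv_le_liminf (v := fun i z => v i z + η z * -(max (v i z - k) 0 + δ))
      (fun i K hK hKW => ?_) (fun K hK hKW => ?_) (fun i => ?_) fun i => ?_
    · obtain ⟨C, hC⟩ := lipschitzWith_mul_neg_max (k := k) (δ := δ) (hv i) hηL hη0 hη1 hT hTW hηT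
      obtain ⟨L', hL'⟩ := hv i K hK hKW
      exact ⟨L' + C, hL'.add hC.lipschitzOnWith⟩
    · have h2 := ENNReal.Tendsto.const_mul (hconv K hK hKW) (Or.inr ENNReal.ofNat_ne_top) (a := 2)
      rw [mul_zero] at h2
      refine tendsto_of_tendsto_of_tendsto_of_le_of_le tendsto_const_nhds h2
          (fun _ => zero_le) fun i => ?_
      dsimp only
      rw [← lintegral_const_mul' _ _ ENNReal.ofNat_ne_top]
      refine lintegral_mono fun z => ?_
      have h3 : (2 : ℝ≥0∞) = ENNReal.ofReal 2 := by simp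
      rw [h3, ← ENNReal.ofReal_mul zero_le_two]
      refine ENNReal.ofReal_le_ofReal ?_
      calc |v i z + η z * -(max (v i z - k) 0 + δ) - (u z + φ z)|
          = |(v i z - u z) + (η z * -(max (v i z - k) 0 + δ) - φ z)| := by congr 1; ring
        _ ≤ |v i z - u z| + |v i z - u z| := (abs_add_le _ _).trans (add_le_add le_rfl (hmd _ _))
        _ = _ := by ring
    · exact ((hgm i).mul (measurable_const.sub (hEη i)).ennreal_ofReal).add
        ((hRm (v i) (hv i) hTW).const_mul _)
    · exact isWeakUpperGradientOn_add_mul_neg_max μ hW (hv i) (hgm i) (hg i) (hfin i) hηL hη0 hη1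
        hT hTW hηT hδ.le
  have hh2 : tv μ (fun y => max (u y - k) 0) (ball x s) ≤ liminf (fun i =>
      ∫⁻ z in ball x s, (W ∩ {z | k < v i z}).indicator (g i) z ∂μ) atTop := by
    have hsW : ball x s ⊆ W := hsT.trans hTW
    refine tv_le_liminf (v := fun i z => max (v i z - k) 0)
      (fun i => ((hv i).max_sub_zero k).mono hsW) (fun K hK hKW => ?_)
      (fun i => (hgm i).indicator (hEo i).measurableSet)
      fun i => (isWeakUpperGradientOn_max_sub_zero μ hW (hv i) (hgm i) (hg i) (hfin i)).mono hsW
    refine tendsto_of_tendsto_of_tendsto_of_le_of_le tendsto_const_nhds (hconv K hK (hKW.trans hsW))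
      (fun _ => zero_le) fun i => lintegral_mono fun z => ENNReal.ofReal_le_ofReal ?_
    exact abs_max_sub_max_le _ _ _
  refine add_le_of_le_liminf hh1 hh2 (c := fun i => c + L * (q +
    ∫⁻ y in T, ENNReal.ofReal |v i y - u y| ∂μ)) (fun i => ?_) ?_
  · calc ∫⁻ z in W, (g i z * ENNReal.ofReal (1 - (W ∩ {z | k < v i z}).indicator η z) +
          L * T.indicator (fun z => ENNReal.ofReal (max (v i z - k) 0 + δ)) z) ∂μ +
          ∫⁻ z in ball x s, (W ∩ {z | k < v i z}).indicator (g i) z ∂μ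
        = ∫⁻ z in W, ((g i z * ENNReal.ofReal (1 - (W ∩ {z | k < v i z}).indicator η z) +
          L * T.indicator (fun z => ENNReal.ofReal (max (v i z - k) 0 + δ)) z) +
          (ball x s).indicator ((W ∩ {z | k < v i z}).indicator (g i)) z) ∂μ := by
          rw [lintegral_add_right _ (((hgm i).indicator (hEo i).measurableSet).indicator
            measurableSet_ball), lintegral_indicator measurableSet_ball,
            Measure.restrict_restrict measurableSet_ball,
            inter_eq_self_of_subset_left (hsT.trans hTW)]
      _ ≤ ∫⁻ z in W, (g i z +
          L * T.indicator (fun z => ENNReal.ofReal (max (v i z - k) 0 + δ)) z) ∂μ := by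
          refine lintegral_mono fun z => ?_
          rw [add_right_comm]
          gcongr
          by_cases hz : z ∈ ball x s
          · by_cases hE : z ∈ W ∩ {z | k < v i z}
            · rw [indicator_of_mem hz, indicator_of_mem hE, indicator_of_mem hE, hη,
                cutoff_eq_one hs (mem_ball.1 hz).le]
              simp
            · rw [indicator_of_mem hz, indicator_of_notMem hE, indicator_of_notMem hE]
              simp
          · rw [indicator_of_notMem hz, add_zero]
            refine mul_le_of_le_one_right' (ENNReal.ofReal_le_one.2 ?_)
            have : 0 ≤ (W ∩ {z | k < v i z}).indicator η z := indicator_nonneg (fun z _ => hη0 z) z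
            linarith
      _ ≤ c + L * (q + ∫⁻ y in T, ENNReal.ofReal |v i y - u y| ∂μ) := by
          rw [lintegral_add_left (hgm i), lintegral_const_mul _ (hRm (v i) (hv i) hTW)]
          gcongr
          · exact (hgc i).le
          · exact (hTind _ _).trans (hqi (v i))
  · have := (ENNReal.Tendsto.const_mul (a := (L : ℝ≥0∞)) ((tendsto_const_nhds (x := q)).add
      (hconv T hT hTW)) (Or.inr ENNReal.coe_ne_top)).const_add c
    rwa [add_zero] at this

/-- The Caccioppoli inequality for minimizers. -/
lemma IsMinimizer.tv_max_sub_le (hX : MMS μ Cd CP lam) (hu : IsMinimizer μ u Ω) {x : X}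
    {s S : ℝ} (k : ℝ) (hs : s < S) (hΩ : closedBall x S ⊆ Ω) :
    tv μ (fun y => max (u y - k) 0) (ball x s) ≤ ENNReal.ofReal (1 / (S - s)) *
      ∫⁻ y in closedBall x S, ENNReal.ofReal (u y - k) ∂μ := by
  have := hX.properSpace
  have := hX.isLocallyFiniteMeasure
  set a := ENNReal.ofReal (1 / (S - s))
  set I := ∫⁻ y in closedBall x S, ENNReal.ofReal (u y - k) ∂μ
  have hμ : μ (closedBall x S) ≠ ⊤ := (isCompact_closedBall x S).measure_lt_top.ne
  have hlim : Tendsto (fun δ : ℝ => a * (I + ENNReal.ofReal δ * μ (closedBall x S))) (𝓝[>] 0)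
      (𝓝 (a * (I + ENNReal.ofReal 0 * μ (closedBall x S)))) := by
    refine ENNReal.Tendsto.const_mul (tendsto_const_nhds.add (ENNReal.Tendsto.mul_const ?_
      (Or.inr hμ))) (Or.inr ENNReal.ofReal_ne_top)
    exact (ENNReal.continuous_ofReal.tendsto 0).mono_left nhdsWithin_le_nhds
  rw [ENNReal.ofReal_zero, zero_mul, add_zero] at hlim
  refine ge_of_tendsto hlim ?_
  filter_upwards [self_mem_nhdsWithin] with δ hδ
  refine (caccioppoli_aux hX hu hs hΩ hδ).trans ?_
  gcongr
  rw [← setLIntegral_const, ← lintegral_add_right _ measurable_const]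
  refine lintegral_mono fun y => ?_
  refine ENNReal.ofReal_add_le.trans (add_le_add ?_ le_rfl)
  rcases le_total (u y - k) 0 with h | h
  · rw [max_eq_right h]; simp
  · rw [max_eq_left h]

end Caccioppoli

section DeGiorgi

variable [BorelSpace X] {μ : Measure X} {Cd CP lam : ℝ} {Ω : Set X} {u : X → ℝ}

lemma MemBVloc.integrableOn {K : Set X} (hu : MemBVloc μ u Ω) (hK : IsCompact K) (hKΩ : K ⊆ Ω) :
    IntegrableOn u K μ := by
  obtain ⟨U, -, hKU, -, hInt, -⟩ := hu K hK hKΩ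
  exact hInt.mono_set hKU

/-- One step of the De Giorgi iteration. -/
lemma IsMinimizer.lintegral_sub_le (hX : MMS μ Cd CP lam) (hu : IsMinimizer μ u Ω) {x : X}
    {R ρ θ k κ : ℝ} {n : ℕ} (hn : lam ≤ 2 ^ n) (hρ : 0 < ρ) (hθ : 0 < θ) (hθlam : lam * θ < 1 / 8)
    (hθC : 48 * CP * θ * Cd ^ (n + 3) * Cd ≤ 1) (hκ : 0 < κ) (hΩ : closedBall x R ⊆ Ω)
    (hdens : ∀ y ∈ closedBall x (R - ρ / 4), 2 * ∫⁻ z in closedBall x R, ENNReal.ofReal (u z - k) ∂μ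
      ≤ ENNReal.ofReal κ * μ (ball y (θ * ρ))) :
    2 * ENNReal.ofReal Cd * ∫⁻ z in closedBall x (R - ρ / 4), ENNReal.ofReal (u z - (k + κ)) ∂μ ≤
      ∫⁻ z in closedBall x R, ENNReal.ofReal (u z - k) ∂μ := by
  have := hX.properSpace
  have hCd0 : 0 < Cd := lt_of_lt_of_le one_pos hX.hCd
  have hθ8 : θ < 1 / 8 := by nlinarith [hX.hlam]
  have hθρ : θ * ρ < ρ / 8 := by nlinarith
  have hlθρ : lam * (θ * ρ) < ρ / 8 := by nlinarith
  have hum : AEMeasurable u (μ.restrict (closedBall x R)) :=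
    (hu.1.integrableOn (isCompact_closedBall x R) hΩ).aemeasurable
  set a := ∫⁻ z in closedBall x R, ENNReal.ofReal (u z - k) ∂μ with ha
  set w : X → ℝ := fun z => max (u z - (k + κ)) 0 with hw
  have hwabs : ∀ z, ENNReal.ofReal |w z| = ENNReal.ofReal (u z - (k + κ)) := fun z => by
    simp only [hw, abs_of_nonneg (le_max_right (u z - (k + κ)) 0)]
    rcases le_total (u z - (k + κ)) 0 with h | h
    · rw [max_eq_right h, ENNReal.ofReal_zero, ENNReal.ofReal_of_nonpos h]
    · rw [max_eq_left h]
  have hκ0 : ENNReal.ofReal κ ≠ 0 := by simpa using hκ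
  have hd : ∀ y ∈ closedBall x (R - ρ / 4),
      2 * μ ({z | w z ≠ 0} ∩ ball y (θ * ρ)) ≤ μ (ball y (θ * ρ)) := by
    intro y hy
    have hsub : ball y (θ * ρ) ⊆ closedBall x R := fun z hz => by
      rw [mem_closedBall] at hy ⊢
      linarith [dist_triangle z y x, mem_ball.1 hz]
    have hf : AEMeasurable (fun z => ENNReal.ofReal (u z - k)) (μ.restrict (ball y (θ * ρ))) :=
      ((hum.mono_measure (Measure.restrict_mono_set μ hsub)).sub_const k).ennreal_ofReal
    have hM : ENNReal.ofReal κ * μ ({z | w z ≠ 0} ∩ ball y (θ * ρ)) ≤ a := by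
      calc ENNReal.ofReal κ * μ ({z | w z ≠ 0} ∩ ball y (θ * ρ))
          ≤ ENNReal.ofReal κ * (μ.restrict (ball y (θ * ρ)))
              {z | ENNReal.ofReal κ ≤ ENNReal.ofReal (u z - k)} := by
            rw [Measure.restrict_apply' measurableSet_ball]
            gcongr with z
            intro hz
            refine ENNReal.ofReal_le_ofReal ?_
            by_contra! h
            exact hz (max_eq_right (by linarith))
        _ ≤ ∫⁻ z in ball y (θ * ρ), ENNReal.ofReal (u z - k) ∂μ :=
            mul_meas_ge_le_lintegral₀ hf _
        _ ≤ a := lintegral_mono_set hsub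
    refine (ENNReal.mul_le_mul_iff_right hκ0 ENNReal.ofReal_ne_top).1 ?_
    calc ENNReal.ofReal κ * (2 * μ ({z | w z ≠ 0} ∩ ball y (θ * ρ)))
        = 2 * (ENNReal.ofReal κ * μ ({z | w z ≠ 0} ∩ ball y (θ * ρ))) := by ring
      _ ≤ 2 * a := by gcongr
      _ ≤ _ := hdens y hy
  have hwm : AEMeasurable w (μ.restrict (ball x (R - ρ / 8))) :=
    ((hum.mono_measure (Measure.restrict_mono_set μ ((ball_subset_ball (by linarith)).trans
      ball_subset_closedBall))).sub_const _).max aemeasurable_const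
  have hS := hX.lintegral_abs_le_tv (w := w) (x := x) (s := R - ρ / 4) (S := R - ρ / 8)
    (mul_pos hθ hρ) (by linarith) hwm hn hd
  have hT := hu.tv_max_sub_le hX (k + κ) (show R - ρ / 8 < R by linarith) hΩ
  simp only [hwabs] at hS
  calc 2 * ENNReal.ofReal Cd * ∫⁻ z in closedBall x (R - ρ / 4), ENNReal.ofReal (u z - (k + κ)) ∂μ
      ≤ 2 * ENNReal.ofReal Cd * (3 * ENNReal.ofReal (CP * (θ * ρ)) * ENNReal.ofReal Cd ^ (n + 3) *
          (ENNReal.ofReal (1 / (R - (R - ρ / 8))) * a)) := by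
        gcongr
        refine hS.trans ?_
        gcongr
        refine hT.trans ?_
        gcongr
        exact lintegral_mono fun z => ENNReal.ofReal_le_ofReal (by linarith)
    _ = ENNReal.ofReal (2 * Cd * (3 * (CP * (θ * ρ)) * Cd ^ (n + 3) * (1 / (R - (R - ρ / 8))))) *
          a := by
        have ht : 0 ≤ CP * (θ * ρ) := by have := hX.hCP; positivity
        generalize CP * (θ * ρ) = t at ht
        rw [ENNReal.ofReal_mul (by positivity), ENNReal.ofReal_mul zero_le_two,
          ENNReal.ofReal_mul (by positivity), ENNReal.ofReal_mul (by positivity),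
          ENNReal.ofReal_mul (by positivity), ENNReal.ofReal_pow hCd0.le]
        simp only [ENNReal.ofReal_ofNat]
        ring
    _ ≤ 1 * a := by
        gcongr
        refine ENNReal.ofReal_le_one.2 (le_trans (le_of_eq ?_) hθC)
        rw [sub_sub_cancel]
        field_simp
        ring
    _ = a := one_mul a

/-- The local boundedness estimate for minimizers. -/
lemma MMS.exists_ae_le_const (hX : MMS μ Cd CP lam) : ∃ C : ℝ≥0∞, C ≠ ⊤ ∧
    ∀ (Ω : Set X) (u : X → ℝ), IsMinimizer μ u Ω → ∀ (x : X) (R k d : ℝ), 0 < R → 0 < d →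
      closedBall x R ⊆ Ω →
      C * ∫⁻ z in closedBall x R, ENNReal.ofReal (u z - k) ∂μ ≤ ENNReal.ofReal d * μ (ball x R) →
      ∀ᵐ y ∂(μ.restrict (ball x (R / 2))), u y ≤ k + d := by
  have := hX.properSpace
  have hCd0 : 0 < Cd := lt_of_lt_of_le one_pos hX.hCd
  obtain ⟨n, hn⟩ := pow_unbounded_of_one_lt lam one_lt_two
  obtain ⟨m, hm⟩ := pow_unbounded_of_one_lt (max (8 * lam) (48 * CP * Cd ^ (n + 3) * Cd))
    one_lt_two
  have hm1 := (le_max_left _ _).trans_lt hm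
  have hm2 := (le_max_right _ _).trans_lt hm
  have h2m : (0 : ℝ) < 2 ^ m := by positivity
  set D := ENNReal.ofReal Cd with hD
  have hD0 : D ≠ 0 := by simpa [hD] using hCd0
  have hD1 : 1 ≤ D := ENNReal.one_le_ofReal.2 hX.hCd
  have hDtop : D ≠ ⊤ := ENNReal.ofReal_ne_top
  refine ⟨4 * D ^ (m + 1), ENNReal.mul_ne_top (by norm_num) (ENNReal.pow_ne_top hDtop),
    fun Ω u hu x R k d hR hd hΩ hsmall => ?_⟩
  set a : ℕ → ℝ≥0∞ := fun j => ∫⁻ z in closedBall x (R / 2 + R * (1 / 2) ^ j / 2),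
    ENNReal.ofReal (u z - (k + d * (1 - (1 / 2) ^ j))) ∂μ with ha
  have ha0 : a 0 = ∫⁻ z in closedBall x R, ENNReal.ofReal (u z - k) ∂μ := by simp [ha]
  rw [← ha0] at hsmall
  have hinv : ∀ j, (2 * D) ^ j * a j ≤ a 0 := by
    intro j
    induction j with
    | zero => simp
    | succ j ih =>
      set ε : ℝ := (1 / 2) ^ j with hε
      have hε0 : 0 < ε := by positivity
      have hε1 : ε ≤ 1 := pow_le_one₀ (by norm_num) (by norm_num)
      have hRj : R / 2 + R * ε / 2 ≤ R := by nlinarith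
      have hstep := hu.lintegral_sub_le hX (x := x) (R := R / 2 + R * ε / 2) (ρ := R * ε)
        (θ := 1 / 2 ^ m) (k := k + d * (1 - ε)) (κ := d * ε / 2) hn.le (by positivity)
        (by positivity) (by rw [mul_one_div, div_lt_iff₀ h2m]; linarith)
        (by
          have : 48 * CP * (1 / 2 ^ m) * Cd ^ (n + 3) * Cd =
            (48 * CP * Cd ^ (n + 3) * Cd) / 2 ^ m := by ring
          rw [this, div_le_one h2m]
          exact hm2.le) (by positivity)
        ((closedBall_subset_closedBall hRj).trans hΩ) ?_
      · have e1 : R / 2 + R * ε / 2 - R * ε / 4 = R / 2 + R * (1 / 2) ^ (j + 1) / 2 := by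
          rw [pow_succ, ← hε]; ring
        have e2 : k + d * (1 - ε) + d * ε / 2 = k + d * (1 - (1 / 2) ^ (j + 1)) := by
          rw [pow_succ, ← hε]; ring
        rw [e1, e2] at hstep
        calc (2 * D) ^ (j + 1) * a (j + 1) = (2 * D) ^ j * (2 * D * a (j + 1)) := by ring
          _ ≤ (2 * D) ^ j * a j := by gcongr
          _ ≤ a 0 := ih
      · intro y hy
        have hr : 0 < 1 / 2 ^ m * (R * ε) := by positivity
        have hyx : dist y x ≤ R := by
          refine (mem_closedBall.1 hy).trans ?_
          nlinarith
        have hball : μ (ball x R) ≤ D ^ (m + j + 1) * μ (ball y (1 / 2 ^ m * (R * ε))) := by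
          refine le_trans (measure_mono fun z hz => ?_) (hX.measure_ball_pow_le y hr (m + j + 1))
          have e3 : (2 : ℝ) ^ (m + j + 1) * (1 / 2 ^ m * (R * ε)) = 2 * R := by
            rw [hε, div_pow, one_pow, pow_succ, pow_add]
            field_simp
          rw [e3, mem_ball]
          linarith [dist_triangle z x y, mem_ball.1 hz, dist_comm x y]
        set B := μ (ball y (1 / 2 ^ m * (R * ε)))
        have hc0 : (2 : ℝ≥0∞) ^ (j + 1) * D ^ (m + j + 1) ≠ 0 :=
          mul_ne_zero (pow_ne_zero _ (by norm_num)) (pow_ne_zero _ hD0)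
        have hctop : (2 : ℝ≥0∞) ^ (j + 1) * D ^ (m + j + 1) ≠ ⊤ :=
          ENNReal.mul_ne_top (ENNReal.pow_ne_top (by norm_num)) (ENNReal.pow_ne_top hDtop)
        refine (ENNReal.mul_le_mul_iff_right hc0 hctop).1 ?_
        calc (2 : ℝ≥0∞) ^ (j + 1) * D ^ (m + j + 1) * (2 * a j)
            = 4 * D ^ (m + 1) * ((2 * D) ^ j * a j) := by ring
          _ ≤ 4 * D ^ (m + 1) * a 0 := by gcongr
          _ ≤ ENNReal.ofReal d * μ (ball x R) := hsmall
          _ ≤ ENNReal.ofReal d * (D ^ (m + j + 1) * B) := by gcongr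
          _ = (2 : ℝ≥0∞) ^ (j + 1) * D ^ (m + j + 1) * (ENNReal.ofReal (d * ε / 2) * B) := by
            have e4 : ENNReal.ofReal d = (2 : ℝ≥0∞) ^ (j + 1) * ENNReal.ofReal (d * ε / 2) := by
              have e5 : (2 : ℝ≥0∞) ^ (j + 1) = ENNReal.ofReal (2 ^ (j + 1)) := by
                rw [ENNReal.ofReal_pow zero_le_two]; simp
              rw [e5, ← ENNReal.ofReal_mul (by positivity), hε, div_pow, one_pow, pow_succ]
              congr 1
              field_simp
            rw [e4]; ring
  have hum : AEMeasurable u (μ.restrict (closedBall x R)) :=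
    (hu.1.integrableOn (isCompact_closedBall x R) hΩ).aemeasurable
  have ha0fin : a 0 ≠ ⊤ := by
    refine ne_top_of_le_ne_top (ENNReal.mul_ne_top ENNReal.ofReal_ne_top
      (hX.measure_ball_lt_top x R).ne) (le_trans ?_ hsmall)
    refine le_mul_of_one_le_left zero_le ?_
    exact one_le_mul (by norm_num) (one_le_pow₀ hD1)
  have hsub : ball x (R / 2) ⊆ closedBall x R :=
    (ball_subset_ball (by linarith)).trans ball_subset_closedBall
  set I := ∫⁻ z in ball x (R / 2), ENNReal.ofReal (u z - (k + d)) ∂μ with hI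
  have hIa : ∀ j, I ≤ a 0 * 2⁻¹ ^ j := by
    intro j
    have h1 : I ≤ a j := by
      refine (lintegral_mono_set ?_).trans (lintegral_mono fun z => ?_)
      · refine (ball_subset_ball ?_).trans ball_subset_closedBall
        have : 0 ≤ R * (1 / 2) ^ j / 2 := by positivity
        linarith
      · refine ENNReal.ofReal_le_ofReal ?_
        have : 0 ≤ d * (1 / 2) ^ j := by positivity
        linarith
    have h2 : (2 : ℝ≥0∞) ^ j * I ≤ a 0 := by
      refine le_trans ?_ (hinv j)
      gcongr
      exact le_mul_of_one_le_right zero_le hD1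
    rw [← ENNReal.inv_pow, ← div_eq_mul_inv, ENNReal.le_div_iff_mul_le (Or.inl (by simp))
      (Or.inl (ENNReal.pow_ne_top (by norm_num))), mul_comm]
    exact h2
  have hI0 : I = 0 := by
    have hlim := ENNReal.Tendsto.const_mul (a := a 0) (ENNReal.tendsto_pow_atTop_nhds_zero_of_lt_one
      (r := 2⁻¹) (by simp)) (Or.inr ha0fin)
    rw [mul_zero] at hlim
    exact le_antisymm (ge_of_tendsto' hlim hIa) zero_le
  have hm' : AEMeasurable (fun z => ENNReal.ofReal (u z - (k + d))) (μ.restrict (ball x (R / 2))) :=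
    ((hum.mono_measure (Measure.restrict_mono_set μ hsub)).sub_const _).ennreal_ofReal
  filter_upwards [(lintegral_eq_zero_iff' hm').1 hI0] with y hy
  have := ENNReal.ofReal_eq_zero.1 hy
  linarith

end DeGiorgi

section Negation

variable {μ : Measure X} {Ω : Set X} {u : X → ℝ}

lemma tv_neg_le (u : X → ℝ) (W : Set X) : tv μ (fun y => -u y) W ≤ tv μ u W := by
  refine le_iInf₂ fun v hv => le_iInf₂ fun hconv g => le_iInf₂ fun hgm hg => ?_
  refine tv_le_liminf (v := fun i z => -v i z) (fun i K hK hKW => ?_) (fun K hK hKW => ?_) hgm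
    fun i => ?_
  · obtain ⟨L, hL⟩ := hv i K hK hKW
    exact ⟨L, hL.neg⟩
  · refine (hconv K hK hKW).congr fun i => lintegral_congr fun z => ?_
    rw [← abs_neg]
    congr 2
    ring
  · obtain ⟨Γ, hΓ, h⟩ := hg i
    refine ⟨Γ, hΓ, fun γ hγ hγW => ?_⟩
    rw [neg_sub_neg, abs_sub_comm]
    exact h γ hγ hγW

lemma tv_neg (u : X → ℝ) (W : Set X) : tv μ (fun y => -u y) W = tv μ u W := by
  refine le_antisymm (tv_neg_le u W) ?_
  simpa using tv_neg_le (μ := μ) (fun y => -u y) W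

lemma tvs_neg (u : X → ℝ) (A : Set X) : tvs μ (fun y => -u y) A = tvs μ u A := by
  simp only [tvs, tv_neg]

lemma MemBV.neg (hu : MemBV μ u Ω) : MemBV μ (fun y => -u y) Ω :=
  ⟨hu.1.neg, by rw [tv_neg]; exact hu.2⟩

lemma IsMinimizer.neg (hu : IsMinimizer μ u Ω) : IsMinimizer μ (fun y => -u y) Ω := by
  refine ⟨fun K hK hKΩ => ?_, fun φ hφ => ?_⟩
  · obtain ⟨U, h1, h2, h3, h4⟩ := hu.1 K hK hKΩ
    exact ⟨U, h1, h2, h3, h4.neg⟩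
  · have hts : tsupport (fun y => -φ y) = tsupport φ := by
      simp [tsupport, Function.support]
    have h := hu.2 (fun y => -φ y) ⟨hφ.1.neg, by rw [hts]; exact hφ.2⟩
    rw [hts] at h
    rw [tvs_neg]
    refine h.trans_eq ?_
    rw [← tvs_neg]
    congr 1
    ext y
    ring

end Negation

section Semicontinuity

variable [BorelSpace X] {μ : Measure X} {Cd CP lam : ℝ} {Ω : Set X} {u : X → ℝ}

lemma IsMinimizer.exists_ae_le (hX : MMS μ Cd CP lam) (hΩ : IsOpen Ω) (hu : IsMinimizer μ u Ω)
    {x : X} (hx : x ∈ Ω) :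
    ∃ r > 0, ∃ M : ℝ, closedBall x r ⊆ Ω ∧ ∀ᵐ y ∂(μ.restrict (ball x r)), u y ≤ M := by
  have := hX.properSpace
  obtain ⟨C, hC, hbound⟩ := hX.exists_ae_le_const
  obtain ⟨R, hR, hRΩ⟩ := Metric.nhds_basis_closedBall.mem_iff.1 (hΩ.mem_nhds hx)
  have hInt := hu.1.integrableOn (isCompact_closedBall x R) hRΩ
  set a := ∫⁻ z in closedBall x R, ENNReal.ofReal (u z - 0) ∂μ with ha
  have hafin : a ≠ ⊤ := by
    refine ne_top_of_le_ne_top hInt.hasFiniteIntegral.ne (lintegral_mono fun z => ?_)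
    rw [sub_zero]
    exact Real.ofReal_le_enorm _
  have hμ0 := (hX.measure_ball_pos x hR).ne'
  have hμt := (hX.measure_ball_lt_top x R).ne
  set q := C * a / μ (ball x R)
  have hq : q ≠ ⊤ := (ENNReal.div_lt_top (ENNReal.mul_ne_top hC hafin) hμ0).ne
  refine ⟨R / 2, half_pos hR, 0 + (q.toReal + 1),
    (closedBall_subset_closedBall (by linarith)).trans hRΩ,
    hbound Ω u hu x R 0 (q.toReal + 1) hR (by positivity) hRΩ ?_⟩
  calc C * a = q * μ (ball x R) := (ENNReal.div_mul_cancel hμ0 hμt).symm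
    _ ≤ ENNReal.ofReal (q.toReal + 1) * μ (ball x R) := by
      gcongr
      rw [← ENNReal.ofReal_toReal hq]
      exact ENNReal.ofReal_le_ofReal (by rw [ENNReal.toReal_ofReal (by positivity)]; linarith)

/-- If the density of a superlevel set vanishes at a point of the domain, then slightly smaller
superlevel sets have vanishing density at all nearby points. -/
lemma IsMinimizer.eventually_tendsto_density (hX : MMS μ Cd CP lam) (hΩ : IsOpen Ω)
    (hu : IsMinimizer μ u Ω) {x : X} (hx : x ∈ Ω) {t d : ℝ} (hd : 0 < d)
    (ht : Tendsto (fun r : ℝ => μ ({y | t < u y} ∩ ball x r) / μ (ball x r)) (𝓝[>] 0) (𝓝 0)) :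
    ∀ᶠ z in 𝓝 x, Tendsto (fun r : ℝ => μ ({y | t + d < u y} ∩ ball z r) / μ (ball z r))
      (𝓝[>] 0) (𝓝 0) := by
  obtain ⟨C, hC, hbound⟩ := hX.exists_ae_le_const
  obtain ⟨r₀, hr₀, M, hr₀Ω, hM⟩ := hu.exists_ae_le hX hΩ hx
  set c := ENNReal.ofReal (M - t)
  set K := C * c * ENNReal.ofReal Cd
  have hK : K ≠ ⊤ := ENNReal.mul_ne_top (ENNReal.mul_ne_top hC ENNReal.ofReal_ne_top)
    ENNReal.ofReal_ne_top
  have hlim := ENNReal.Tendsto.const_mul (a := K) ht (Or.inr hK)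
  rw [mul_zero] at hlim
  have hev := (hlim.eventually (Iio_mem_nhds (ENNReal.ofReal_pos.2 hd))).and
    (Ioo_mem_nhdsGT hr₀)
  obtain ⟨ρ, hρ, hρ0, hρr⟩ := hev.exists
  have hR : 0 < ρ / 2 := half_pos hρ0
  have hμ0 := (hX.measure_ball_pos x hρ0).ne'
  have hμt := (hX.measure_ball_lt_top x ρ).ne
  have hdoub : μ (ball x ρ) ≤ ENNReal.ofReal Cd * μ (ball x (ρ / 2)) := by
    have := (hX.doubling x (ρ / 2) hR).2.1
    rwa [mul_div_cancel₀ _ (two_ne_zero' ℝ)] at this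
  have hInt : ∫⁻ z in closedBall x (ρ / 2), ENNReal.ofReal (u z - t) ∂μ ≤
      c * μ ({y | t < u y} ∩ ball x ρ) := by
    calc ∫⁻ z in closedBall x (ρ / 2), ENNReal.ofReal (u z - t) ∂μ
        ≤ ∫⁻ z in ball x ρ, ENNReal.ofReal (u z - t) ∂μ :=
          lintegral_mono_set (closedBall_subset_ball (by linarith))
      _ ≤ ∫⁻ z in ball x ρ, {y | t < u y}.indicator (fun _ => c) z ∂μ := by
          refine lintegral_mono_ae ?_
          filter_upwards [ae_restrict_of_ae_restrict_of_subset (ball_subset_ball hρr.le) hM]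
            with z hz
          by_cases h : t < u z
          · rw [indicator_of_mem (show z ∈ {y | t < u y} from h)]
            exact ENNReal.ofReal_le_ofReal (by linarith)
          · rw [ENNReal.ofReal_of_nonpos (by linarith)]
            exact zero_le
      _ ≤ c * (μ.restrict (ball x ρ)) {y | t < u y} := lintegral_indicator_const_le _ _
      _ = c * μ ({y | t < u y} ∩ ball x ρ) := by rw [Measure.restrict_apply' measurableSet_ball]
  have hae := hbound Ω u hu x (ρ / 2) t d hR hd
    ((closedBall_subset_closedBall (by linarith)).trans hr₀Ω) (by
      calc C * ∫⁻ z in closedBall x (ρ / 2), ENNReal.ofReal (u z - t) ∂μ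
          ≤ C * (c * μ ({y | t < u y} ∩ ball x ρ)) := by gcongr
        _ = C * c * (μ ({y | t < u y} ∩ ball x ρ) / μ (ball x ρ) * μ (ball x ρ)) := by
            rw [ENNReal.div_mul_cancel hμ0 hμt, mul_assoc]
        _ ≤ C * c * (μ ({y | t < u y} ∩ ball x ρ) / μ (ball x ρ) *
              (ENNReal.ofReal Cd * μ (ball x (ρ / 2)))) := by gcongr
        _ = K * (μ ({y | t < u y} ∩ ball x ρ) / μ (ball x ρ)) * μ (ball x (ρ / 2)) := by ring
        _ ≤ ENNReal.ofReal d * μ (ball x (ρ / 2)) := by gcongr)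
  have hnull : μ ({y | t + d < u y} ∩ ball x (ρ / 2 / 2)) = 0 := by
    rw [← Measure.restrict_apply' measurableSet_ball]
    refine measure_mono_null (fun y hy => ?_) (ae_iff.1 hae)
    exact not_le.2 hy
  filter_upwards [ball_mem_nhds x (half_pos hR)] with z hz
  obtain ⟨ε, hε, hεsub⟩ := Metric.isOpen_iff.1 isOpen_ball z hz
  refine tendsto_const_nhds.congr' ?_
  filter_upwards [Ioo_mem_nhdsGT hε] with r hr
  rw [measure_mono_null (inter_subset_inter_right _ ((ball_subset_ball hr.2.le).trans hεsub)) hnull,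
    ENNReal.zero_div]

lemma IsMinimizer.eventually_upperApprox_lt (hX : MMS μ Cd CP lam) (hΩ : IsOpen Ω)
    (hu : IsMinimizer μ u Ω) {x : X} (hx : x ∈ Ω) {c : EReal} (hc : upperApprox μ u x < c) :
    ∀ᶠ z in 𝓝 x, upperApprox μ u z < c := by
  obtain ⟨_, ⟨t, ht, rfl⟩, htc⟩ := sInf_lt_iff.1 hc
  obtain ⟨s, hts, hsc⟩ := EReal.lt_iff_exists_real_btwn.1 htc
  have hts' : 0 < s - t := sub_pos.2 (EReal.coe_lt_coe_iff.1 hts)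
  filter_upwards [hu.eventually_tendsto_density hX hΩ hx hts' ht] with z hz
  rw [add_sub_cancel] at hz
  exact (show upperApprox μ u z ≤ (s : EReal) from sInf_le ⟨s, hz, rfl⟩).trans_lt hsc

lemma IsMinimizer.eventually_lt_lowerApprox (hX : MMS μ Cd CP lam) (hΩ : IsOpen Ω)
    (hu : IsMinimizer μ u Ω) {x : X} (hx : x ∈ Ω) {c : EReal} (hc : c < lowerApprox μ u x) :
    ∀ᶠ z in 𝓝 x, c < lowerApprox μ u z := by
  obtain ⟨_, ⟨t, ht, rfl⟩, htc⟩ := lt_sSup_iff.1 hc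
  obtain ⟨s, hcs, hst⟩ := EReal.lt_iff_exists_real_btwn.1 htc
  have hst' : 0 < t - s := sub_pos.2 (EReal.coe_lt_coe_iff.1 hst)
  have hset : ∀ a : ℝ, {y | u y < a} = {y | -a < -u y} := fun a => by
    ext y; simp only [mem_ofPred_eq, neg_lt_neg_iff]
  simp only [mem_ofPred_eq, hset] at ht
  filter_upwards [hu.neg.eventually_tendsto_density hX hΩ hx hst' ht] with z hz
  rw [show -t + (t - s) = -s by ring] at hz
  refine hcs.trans_le (le_sSup ⟨s, ?_, rfl⟩)
  simpa only [mem_ofPred_eq, hset] using hz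

lemma MMS.lowerApprox_le_upperApprox (hX : MMS μ Cd CP lam) (u : X → ℝ) (x : X) :
    lowerApprox μ u x ≤ upperApprox μ u x := by
  refine sSup_le ?_
  rintro _ ⟨s, hs, rfl⟩
  refine le_sInf ?_
  rintro _ ⟨t, ht, rfl⟩
  rw [EReal.coe_le_coe_iff]
  by_contra! hts
  have hlim := Tendsto.add hs ht
  rw [add_zero] at hlim
  have hge : (1 : ℝ≥0∞) ≤ 0 := by
    refine ge_of_tendsto hlim ?_
    filter_upwards [self_mem_nhdsWithin] with r hr
    rw [← ENNReal.add_div, ENNReal.le_div_iff_mul_le (Or.inl (hX.measure_ball_pos x hr).ne')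
      (Or.inl (hX.measure_ball_lt_top x r).ne), one_mul]
    refine (measure_mono fun y hy => ?_).trans (measure_union_le _ _)
    rcases lt_or_ge (u y) s with h | h
    exacts [Or.inl ⟨h, hy⟩, Or.inr ⟨hts.trans_le h, hy⟩]
  exact absurd hge (by norm_num)

end Semicontinuity

/-- If `u` is a 1-minimizer in an open set `Ω` and `S_u = {u^∧ < u^∨}` is its jump set, then
`u^∨`, `u^∧` and the precise representative `ũ = (u^∧ + u^∨)/2` are continuous at every point
of `Ω ∖ S_u`. -/
theorem minimizer_continuous_outside_jump_set
    {X : Type*} [MetricSpace X] [MeasurableSpace X] [BorelSpace X]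
    (μ : Measure X) (Cd CP lam : ℝ) (hX : MMS μ Cd CP lam)
    (Ω : Set X) (hΩopen : IsOpen Ω) (u : X → ℝ)
    (hu : IsMinimizer μ u Ω) :
    ∀ x ∈ Ω \ {y : X | lowerApprox μ u y < upperApprox μ u y},
      ContinuousWithinAt (upperApprox μ u) Ω x ∧
      ContinuousWithinAt (lowerApprox μ u) Ω x ∧
      ContinuousWithinAt
        (fun y => (((1 : ℝ) / 2 : ℝ) : EReal) * (lowerApprox μ u y + upperApprox μ u y))
        Ω x := by
  rintro x ⟨hx, hxS⟩
  have hle := fun y => hX.lowerApprox_le_upperApprox u y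
  have heq : lowerApprox μ u x = upperApprox μ u x := le_antisymm (hle x) (not_lt.1 hxS)
  have hup : ContinuousAt (upperApprox μ u) x := tendsto_order.2
    ⟨fun c hc => (hu.eventually_lt_lowerApprox hX hΩopen hx (heq ▸ hc)).mono
        fun y hy => hy.trans_le (hle y),
      fun c hc => hu.eventually_upperApprox_lt hX hΩopen hx hc⟩
  have hlow : ContinuousAt (lowerApprox μ u) x := tendsto_order.2
    ⟨fun c hc => hu.eventually_lt_lowerApprox hX hΩopen hx hc,
      fun c hc => (hu.eventually_upperApprox_lt hX hΩopen hx (heq ▸ hc)).mono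
        fun y hy => (hle y).trans_lt hy⟩
  refine ⟨hup.continuousWithinAt, hlow.continuousWithinAt, ContinuousAt.continuousWithinAt ?_⟩
  have hne : upperApprox μ u x ≠ ⊤ ∨ upperApprox μ u x ≠ ⊥ := by
    by_cases h : upperApprox μ u x = ⊤
    exacts [Or.inr (h ▸ top_ne_bot), Or.inl h]
  have hsum : ContinuousAt (fun y => lowerApprox μ u y + upperApprox μ u y) x := by
    refine ContinuousAt.comp₂ (f := fun p : EReal × EReal => p.1 + p.2)
      (EReal.continuousAt_add (hne.imp_left heq.trans_ne) (hne.symm.imp_left heq.trans_ne)) hlow hup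
  refine ContinuousAt.comp₂ (f := fun p : EReal × EReal => p.1 * p.2)
    (EReal.continuousAt_mul ?_ ?_ ?_ ?_) continuousAt_const hsum
  · exact Or.inl (EReal.coe_ne_zero.2 (by norm_num))
  · exact Or.inl (EReal.coe_ne_zero.2 (by norm_num))
  · exact Or.inl (EReal.coe_ne_bot _)
  · exact Or.inl (EReal.coe_ne_top _)

end MetricBV
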